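/- arXiv:2112.14421 — 4 statements merged into one kernel-verified Lean document; each statement's English description precedes it below -/
import Mathlib

section
/- If $(A_1,\dots,A_k)$ are closed subsets of the $(k-1)$-dimensional simplex $\Delta^{k-1}=\mathrm{conv}\{v_1,\dots,v_k\}$ such that every face $\sigma$ of $\Delta^{k-1}$ satisfies $\sigma \subseteq \bigcup_{v_i \in \sigma} A_i$, then $\bigcap_{i=1}^k A_i \neq \emptyset$. -/
open Set

section Scarf
variable {α I : Type} [Fintype α] [DecidableEq α] [Fintype I] [DecidableEq I]

/-- Scarf's dominance of a finite set with respect to a family of rankings. -/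
def KDom (r : I → α → ℕ) (X : Finset α) : Prop := ∀ y, ∃ i, ∀ x ∈ X, r i y ≤ r i x

lemma kkm_two_indices (Y : Finset α) (hcard : Y.card + 1 = Fintype.card I) (m : I → α)
    (hm : ∀ i, m i ∈ Y) (hs : ∀ y ∈ Y, ∃ i, m i = y) :
    ∃ a b, a ≠ b ∧ m a = m b ∧ ∀ i j, i ≠ j → m i = m j → (i = a ∧ j = b) ∨ (i = b ∧ j = a) := by
  obtain ⟨a, -, b, -, hab, hmab⟩ := Finset.exists_ne_map_eq_of_card_lt_of_maps_to
    (s := (Finset.univ : Finset I)) (t := Y) (f := m)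
    (by rw [Finset.card_univ]; omega) (fun i _ => hm i)
  have key : ∀ a b, a ≠ b → m a = m b → Set.InjOn m (Finset.univ.erase a : Finset I) := by
    intro a b hab hmab
    apply Finset.injOn_of_card_image_eq
    have : (Finset.univ.erase a).image m = Y := by
      ext y
      simp only [Finset.mem_image, Finset.mem_erase, Finset.mem_univ, and_true]
      constructor
      · rintro ⟨i, -, rfl⟩; exact hm i
      · intro hy
        obtain ⟨i, rfl⟩ := hs y hy
        by_cases h : i = a
        · exact ⟨b, hab.symm, by rw [h, hmab]⟩
        · exact ⟨i, h, rfl⟩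
    rw [this, Finset.card_erase_of_mem (Finset.mem_univ _), Finset.card_univ]; omega
  have h1 := key a b hab hmab
  have h2 := key b a hab.symm hmab.symm
  refine ⟨a, b, hab, hmab, fun i j hij hmij => ?_⟩
  have h3 : i = a ∨ j = a := by
    by_contra! h
    exact hij (h1 (by simp [h.1]) (by simp [h.2]) hmij)
  have h4 : i = b ∨ j = b := by
    by_contra! h
    exact hij (h2 (by simp [h.1]) (by simp [h.2]) hmij)
  grind

open Classical in
lemma kkm_door_even (r : I → α → ℕ) (hr : ∀ i, Function.Injective (r i)) (Y : Finset α)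
    (hne : Y.Nonempty) (hcard : Y.card + 1 = Fintype.card I)
    (hM : ∀ a, ∃ y, ∀ i, i ≠ a → ∃ x ∈ Y, r i x < r i y) :
    ¬ Odd (Finset.univ.filter (fun x => x ∉ Y ∧ KDom r (insert x Y))).card := by
  by_cases hex : ∃ x, x ∉ Y ∧ KDom r (insert x Y)
  swap
  · have : Finset.univ.filter (fun x => x ∉ Y ∧ KDom r (insert x Y)) = ∅ := by
      ext x; simp only [Finset.mem_filter, Finset.mem_univ, true_and, Finset.notMem_empty, iff_false]
      exact fun h => hex ⟨x, h⟩
    rw [this]; simp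
  obtain ⟨x0, hx0, hD0⟩ := hex
  have hDY : KDom r Y := fun y => by
    obtain ⟨i, hi⟩ := hD0 y
    exact ⟨i, fun x hx => hi x (Finset.mem_insert_of_mem hx)⟩
  choose m hm hmin using fun i => Finset.exists_min_image Y (r i) hne
  have hs : ∀ y ∈ Y, ∃ i, m i = y := fun y hy => by
    obtain ⟨i, hi⟩ := hDY y
    exact ⟨i, hr i (le_antisymm (hmin i y hy) (hi _ (hm i)))⟩
  obtain ⟨a, b, hab, hmab, huniq⟩ := kkm_two_indices Y hcard m hm hs
  have hNo : ∀ y, ¬ ∀ i, r i (m i) < r i y := fun y h => by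
    obtain ⟨i, hi⟩ := hDY y
    exact absurd (hi _ (hm i)) (not_le.2 (h i))
  -- argmax elements
  have hA : ∀ a, ∃ x, (∀ i, i ≠ a → r i (m i) < r i x) ∧
      ∀ y, (∀ i, i ≠ a → r i (m i) < r i y) → r a y ≤ r a x := fun a => by
    obtain ⟨y0, hy0⟩ := hM a
    obtain ⟨x, hx, hx'⟩ := Finset.exists_max_image
      (Finset.univ.filter (fun y => ∀ i, i ≠ a → r i (m i) < r i y)) (r a)
      ⟨y0, by
        simp only [Finset.mem_filter, Finset.mem_univ, true_and]
        intro i hi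
        obtain ⟨x, hx, hlt⟩ := hy0 i hi
        exact lt_of_le_of_lt (hmin i x hx) hlt⟩
    simp only [Finset.mem_filter, Finset.mem_univ, true_and] at hx hx'
    exact ⟨x, hx, hx'⟩
  choose p hp1 hp2 using hA
  have hback : ∀ a b, a ≠ b → m a = m b → (p a ∉ Y ∧ KDom r (insert (p a) Y)) := by
    intro a b hab hmab
    constructor
    · intro hY
      obtain ⟨i, hi⟩ := hs _ hY
      by_cases h : i = a
      · have := hp1 a b hab.symm
        rw [← hi, h, hmab] at this
        exact lt_irrefl _ this
      · have := hp1 a i h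
        rw [← hi] at this
        exact lt_irrefl _ this
    · intro y
      by_cases h : ∃ i, i ≠ a ∧ r i y ≤ r i (m i)
      · obtain ⟨i, hia, hi⟩ := h
        refine ⟨i, fun x hx => ?_⟩
        rcases Finset.mem_insert.1 hx with rfl | hx
        · exact hi.trans (hp1 a i hia).le
        · exact hi.trans (hmin i x hx)
      · push Not at h
        refine ⟨a, fun x hx => ?_⟩
        rcases Finset.mem_insert.1 hx with rfl | hx
        · exact hp2 a y h
        · refine le_trans ?_ (hmin a x hx)
          by_contra! hlt
          exact hNo y fun i => by
            by_cases hi : i = a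
            · rw [hi]; exact hlt
            · exact h i hi
  have hset : Finset.univ.filter (fun x => x ∉ Y ∧ KDom r (insert x Y)) = {p a, p b} := by
    ext x
    simp only [Finset.mem_filter, Finset.mem_univ, true_and, Finset.mem_insert,
      Finset.mem_singleton]
    constructor
    · rintro ⟨hxY, hD⟩
      obtain ⟨j, hj⟩ := hD x
      -- each y in Y has an index where it is the strict minimum
      have hP : ∀ y ∈ Y, ∃ i, m i = y ∧ r i y < r i x := fun y hy => by
        obtain ⟨i, hi⟩ := hD y
        refine ⟨i, hr i (le_antisymm (hmin i y hy) (hi _ (Finset.mem_insert_of_mem (hm i)))), ?_⟩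
        refine lt_of_le_of_ne (hi x (Finset.mem_insert_self _ _)) fun h => ?_
        exact hxY (hr i h ▸ hy)
      have hjn : ¬ r j (m j) < r j x := not_lt.2 (hj _ (Finset.mem_insert_of_mem (hm j)))
      have hxM : ∀ i, i ≠ j → r i (m i) < r i x := by
        intro i hij
        by_contra hcon
        obtain ⟨i', h1, h2⟩ := hP (m i) (hm i)
        obtain ⟨j', h3, h4⟩ := hP (m j) (hm j)
        have hi' : i' ≠ i := by rintro rfl; exact hcon h2
        have hj' : j' ≠ j := by rintro rfl; exact hjn h4
        have hi'j : i' ≠ j := by rintro rfl; exact hjn (h1 ▸ h2)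
        have hj'i : j' ≠ i := by rintro rfl; exact hcon (h3 ▸ h4)
        have e1 := huniq i' i hi' h1
        have e2 := huniq j' j hj' h3
        grind
      have hjab : j = a ∨ j = b := by
        obtain ⟨j', h3, h4⟩ := hP (m j) (hm j)
        have hj' : j' ≠ j := by rintro rfl; exact hjn h4
        have e2 := huniq j' j hj' h3
        grind
      have hxp : x = p j := by
        apply hr j
        refine le_antisymm (hp2 j x hxM) ?_
        by_contra! hlt
        obtain ⟨i, hi⟩ := hD (p j)
        by_cases hij : i = j
        · subst hij
          exact absurd (hi x (Finset.mem_insert_self _ _)) (not_le.2 hlt)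
        · exact absurd (hi _ (Finset.mem_insert_of_mem (hm i))) (not_le.2 (hp1 j i hij))
      rcases hjab with rfl | rfl
      · exact Or.inl hxp
      · exact Or.inr hxp
    · rintro (rfl | rfl)
      · exact hback a b hab hmab
      · exact hback b a hab.symm hmab.symm
  have hpab : p a ≠ p b := fun h => hNo (p a) fun i => by
    by_cases hi : i = a
    · rw [h]; exact hp1 b i (hi ▸ hab)
    · exact hp1 a i hi
  rw [hset, Finset.card_pair hpab]
  decide

open Classical in
lemma kkm_room_parity (c : α → I) (i0 : I) (X : Finset α) (hX : X.card = Fintype.card I)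
    (hodd : Odd (X.filter (fun x => (X.erase x).image c = Finset.univ.erase i0)).card) :
    X.image c = Finset.univ := by
  by_contra hnot
  have hne : (X.filter (fun x => (X.erase x).image c = Finset.univ.erase i0)).Nonempty := by
    rw [← Finset.card_pos]; exact hodd.pos
  obtain ⟨x, hx⟩ := hne
  rw [Finset.mem_filter] at hx
  obtain ⟨hxX, hxc⟩ := hx
  have hcx : c x ≠ i0 := by
    intro h
    apply hnot
    rw [← Finset.insert_erase hxX, Finset.image_insert, hxc, h]
    exact Finset.insert_erase (Finset.mem_univ _)
  have hinj : Set.InjOn c (X.erase x : Finset α) := by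
    apply Finset.injOn_of_card_image_eq
    rw [hxc, Finset.card_erase_of_mem (Finset.mem_univ _), Finset.card_erase_of_mem hxX, hX,
      Finset.card_univ]
  have : c x ∈ (X.erase x).image c := by rw [hxc]; simp [hcx]
  obtain ⟨x', hx', hcc⟩ := Finset.mem_image.1 this
  have hxx' : x' ≠ x := Finset.ne_of_mem_erase hx'
  have hx'X : x' ∈ X := Finset.mem_of_mem_erase hx'
  have hset : X.filter (fun x => (X.erase x).image c = Finset.univ.erase i0) = {x, x'} := by
    ext z
    simp only [Finset.mem_filter, Finset.mem_insert, Finset.mem_singleton]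
    constructor
    · rintro ⟨hzX, hz⟩
      by_contra! hzn
      -- c z is attained in X.erase z
      have h1 : c z ∈ (X.erase x).image c := Finset.mem_image_of_mem c (by simp [hzX, hzn.1])
      rw [hxc, ← hz] at h1
      obtain ⟨w, hw, hwc⟩ := Finset.mem_image.1 h1
      have hwz := Finset.ne_of_mem_erase hw
      have hwX := Finset.mem_of_mem_erase hw
      by_cases hwx : w = x
      · subst hwx
        have := hinj (by simp [hx'X, hxx']) (by simp [hzX, hzn.1]) (hcc.trans hwc)
        exact hzn.2 this.symm
      · exact hwz (hinj (by simp [hwX, hwx]) (by simp [hzX, hzn.1]) hwc)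
    · rintro (rfl | rfl)
      · exact ⟨hxX, hxc⟩
      · refine ⟨hx'X, ?_⟩
        rw [← hxc]
        ext t
        simp only [Finset.mem_image, Finset.mem_erase]
        constructor
        · rintro ⟨u, ⟨hu1, hu2⟩, rfl⟩
          by_cases hux : u = x
          · exact ⟨z, ⟨hxx', hx'X⟩, by rw [hux, hcc]⟩
          · exact ⟨u, ⟨hux, hu2⟩, rfl⟩
        · rintro ⟨u, ⟨hu1, hu2⟩, rfl⟩
          by_cases hux : u = z
          · exact ⟨x, ⟨hxx'.symm, hxX⟩, by rw [hux, hcc]⟩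
          · exact ⟨u, ⟨hux, hu2⟩, rfl⟩
  rw [hset, Finset.card_pair hxx'.symm] at hodd
  exact absurd hodd (by decide)

open Classical in
lemma kkm_sperner (r : I → α → ℕ) (c : α → I) (i0 : I) (Y0 : Finset α)
    (hY0 : Y0.card + 1 = Fintype.card I) (hY0c : Y0.image c = Finset.univ.erase i0)
    (hodd : Odd (Finset.univ.filter (fun x => x ∉ Y0 ∧ KDom r (insert x Y0))).card)
    (heven : ∀ Y : Finset α, Y.card + 1 = Fintype.card I → Y.image c = Finset.univ.erase i0 →
      Y ≠ Y0 → ¬ Odd (Finset.univ.filter (fun x => x ∉ Y ∧ KDom r (insert x Y))).card) :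
    ∃ X : Finset α, KDom r X ∧ X.image c = Finset.univ := by
  let G : Finset (Finset α) := Finset.univ.filter
    (fun Y => Y.card + 1 = Fintype.card I ∧ Y.image c = Finset.univ.erase i0)
  let R : Finset (Finset α) := Finset.univ.filter
    (fun X => X.card = Fintype.card I ∧ KDom r X)
  have hsum : ∑ Y ∈ G, (Finset.univ.filter (fun x => x ∉ Y ∧ KDom r (insert x Y))).card
      = ∑ X ∈ R, (X.filter (fun x => (X.erase x).image c = Finset.univ.erase i0)).card := by
    rw [← Finset.card_sigma, ← Finset.card_sigma]
    refine Finset.card_bij' (fun q _ => ⟨insert q.2 q.1, q.2⟩) (fun q _ => ⟨q.1.erase q.2, q.2⟩)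
      ?_ ?_ ?_ ?_
    · rintro ⟨Y, x⟩ h
      simp only [Finset.mem_sigma, Finset.mem_filter, Finset.mem_univ, true_and, G, R] at h ⊢
      obtain ⟨⟨h1, h2⟩, h3, h4⟩ := h
      refine ⟨⟨?_, h4⟩, Finset.mem_insert_self _ _, ?_⟩
      · rw [Finset.card_insert_of_notMem h3, h1]
      · rw [Finset.erase_insert h3, h2]
    · rintro ⟨X, x⟩ h
      simp only [Finset.mem_sigma, Finset.mem_filter, Finset.mem_univ, true_and, G, R] at h ⊢
      obtain ⟨⟨h1, h2⟩, h3, h4⟩ := h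
      refine ⟨⟨?_, h4⟩, Finset.notMem_erase _ _, ?_⟩
      · rw [Finset.card_erase_add_one h3, h1]
      · rw [Finset.insert_erase h3]; exact h2
    · rintro ⟨Y, x⟩ h
      simp only [Finset.mem_sigma, Finset.mem_filter, Finset.mem_univ, true_and, G] at h
      simp [Finset.erase_insert h.2.1]
    · rintro ⟨X, x⟩ h
      simp only [Finset.mem_sigma, Finset.mem_filter, Finset.mem_univ, true_and, R] at h
      simp [Finset.insert_erase h.2.1]
  have hO : Odd (∑ Y ∈ G, (Finset.univ.filter (fun x => x ∉ Y ∧ KDom r (insert x Y))).card) := by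
    rw [Finset.odd_sum_iff_odd_card_odd]
    have : G.filter (fun Y => Odd (Finset.univ.filter
        (fun x => x ∉ Y ∧ KDom r (insert x Y))).card) = {Y0} := by
      ext Y
      rw [Finset.mem_filter, Finset.mem_singleton]
      constructor
      · rintro ⟨h1, h2⟩
        by_contra hne
        have h1' := (Finset.mem_filter.1 h1).2
        exact heven Y h1'.1 h1'.2 hne h2
      · rintro rfl
        exact ⟨Finset.mem_filter.2 ⟨Finset.mem_univ _, hY0, hY0c⟩, hodd⟩
    rw [this]; simp
  rw [hsum, Finset.odd_sum_iff_odd_card_odd] at hO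
  obtain ⟨X, hX⟩ := Finset.card_pos.1 hO.pos
  rw [Finset.mem_filter] at hX
  have hXR := (Finset.mem_filter.1 hX.1).2
  exact ⟨X, hXR.2, kkm_room_parity c i0 X hXR.1 hX.2⟩

/-- Scarf-type lemma with slack elements. -/
lemma kkm_scarf {T : Type} [Fintype T] [DecidableEq T] [Nonempty T] [Nonempty I]
    (r : I → T ⊕ I → ℕ) (hr : ∀ i, Function.Injective (r i))
    (h1 : ∀ i t, r i (Sum.inr i) < r i (Sum.inl t))
    (h2 : ∀ i j t, j ≠ i → r i (Sum.inl t) < r i (Sum.inr j)) (c : T → I) :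
    ∃ X : Finset (T ⊕ I), KDom r X ∧ X.image (Sum.elim c id) = Finset.univ := by
  classical
  obtain ⟨i0⟩ := ‹Nonempty I›
  have h1' : ∀ i y, y ≠ Sum.inr i → r i (Sum.inr i) < r i y := by
    rintro i (t | j) hy
    · exact h1 i t
    · exact (h1 i (Classical.arbitrary T)).trans (h2 i j _ (by rintro rfl; exact hy rfl))
  have hcY0 : ((Finset.univ.erase i0).image (Sum.inr : I → T ⊕ I)).card + 1 = Fintype.card I := by
    rw [Finset.card_image_of_injective _ Sum.inr_injective,
      Finset.card_erase_add_one (Finset.mem_univ _), Finset.card_univ]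
  refine kkm_sperner r (Sum.elim c id) i0 ((Finset.univ.erase i0).image Sum.inr) hcY0 ?_ ?_ ?_
  · rw [Finset.image_image]; simp
  · obtain ⟨t, -, ht⟩ := Finset.exists_max_image (Finset.univ : Finset T)
      (fun t => r i0 (Sum.inl t)) Finset.univ_nonempty
    have : Finset.univ.filter (fun x => x ∉ (Finset.univ.erase i0).image (Sum.inr : I → T ⊕ I) ∧
        KDom r (insert x ((Finset.univ.erase i0).image Sum.inr))) = {Sum.inl t} := by
      ext x
      simp only [Finset.mem_filter, Finset.mem_univ, true_and, Finset.mem_singleton]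
      constructor
      · rintro ⟨hx, hD⟩
        obtain ⟨i, hi⟩ := hD (Sum.inl t)
        have hii : i = i0 := by
          by_contra hne
          exact absurd (hi (Sum.inr i) (Finset.mem_insert_of_mem (by simp [hne])))
            (not_le.2 (h1 i t))
        subst hii
        have hle := hi x (Finset.mem_insert_self _ _)
        rcases x with t' | j
        · exact hr i (le_antisymm (ht t' (Finset.mem_univ _)) hle)
        · have : j = i := by
            by_contra hne
            exact hx (by simp [hne])
          subst this
          exact absurd hle (not_le.2 (h1 j t))
      · rintro rfl
        refine ⟨by simp, ?_⟩
        rintro (t' | j)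
        · refine ⟨i0, fun x hx => ?_⟩
          rcases Finset.mem_insert.1 hx with rfl | hx
          · exact ht t' (Finset.mem_univ _)
          · simp only [Finset.mem_image, Finset.mem_erase, Finset.mem_univ, and_true] at hx
            obtain ⟨j, hj, rfl⟩ := hx
            exact (h2 _ _ _ hj).le
        · refine ⟨j, fun x _ => ?_⟩
          by_cases hx : x = Sum.inr j
          · rw [hx]
          · exact (h1' j x hx).le
    rw [this]; simp
  · intro Y hY hYc hne
    have hT : ∃ t, Sum.inl t ∈ Y := by
      by_contra! hno
      apply hne
      ext x
      simp only [Finset.mem_image, Finset.mem_erase, Finset.mem_univ, and_true]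
      have hmem : ∀ j, j ≠ i0 ↔ Sum.inr j ∈ Y := by
        intro j
        have : j ∈ Y.image (Sum.elim c id) ↔ j ∈ Finset.univ.erase i0 := by rw [hYc]
        simp only [Finset.mem_image, Finset.mem_erase, Finset.mem_univ, and_true] at this
        rw [← this]
        constructor
        · rintro ⟨t | j', hx, he⟩
          · exact absurd hx (hno t)
          · simp only [Sum.elim_inr, id] at he
            rw [← he]; exact hx
        · intro h; exact ⟨_, h, rfl⟩
      rcases x with t | j
      · simp [hno t]
      · simp [← hmem j]
    obtain ⟨t, ht⟩ := hT
    exact kkm_door_even r hr Y ⟨_, ht⟩ hY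
      fun a => ⟨Sum.inr a, fun i hi => ⟨Sum.inl t, ht, h2 i a t hi.symm⟩⟩
end Scarf

/-- Grid points of the simplex. -/
abbrev KGrid (k n : ℕ) : Type := {f : Fin k → Fin (n + 1) // ∑ i, (f i : ℕ) = n}

lemma kkm_grid_exists (k n : ℕ) (a : Fin k) (g : Fin k → ℕ) (hg : ∑ i, g i ≤ n) :
    ∃ t : KGrid k n, ∀ i, g i ≤ (t.1 i : ℕ) := by
  classical
  let f : Fin k → ℕ := fun i => g i + if i = a then n - ∑ i, g i else 0
  have hf : ∑ i, f i = n := by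
    simp only [f, Finset.sum_add_distrib, Finset.sum_ite_eq', Finset.mem_univ, if_true]
    omega
  have hlt : ∀ i, f i < n + 1 := fun i => by
    have := Finset.single_le_sum (f := f) (fun _ _ => Nat.zero_le _) (Finset.mem_univ i)
    omega
  exact ⟨⟨fun i => ⟨f i, hlt i⟩, hf⟩, fun i => by simp [f]⟩

lemma kkm_grid (k n : ℕ) (hk : 0 < k) (c : KGrid k n → Fin k) :
    ∃ t0 : KGrid k n, ∀ i, (t0.1 i : ℕ) ≤ k ∨
      ∃ t : KGrid k n, c t = i ∧ ∀ j, (t.1 j : ℕ) ≤ t0.1 j + k ∧ (t0.1 j : ℕ) ≤ t.1 j + k := by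
  classical
  haveI : Nonempty (Fin k) := ⟨⟨0, hk⟩⟩
  obtain ⟨tt, -⟩ := kkm_grid_exists k n ⟨0, hk⟩ (fun _ => 0) (by simp)
  haveI : Nonempty (KGrid k n) := ⟨tt⟩
  let N := Fintype.card (KGrid k n)
  let e : KGrid k n ≃ Fin N := Fintype.equivFin _
  let r : Fin k → KGrid k n ⊕ Fin k → ℕ := fun i y => match y with
    | Sum.inl t => (t.1 i : ℕ) * N + e t + 1
    | Sum.inr j => if j = i then 0 else (n + 1) * N + 1 + j
  have hmono : ∀ i (t t' : KGrid k n), (t.1 i : ℕ) < t'.1 i →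
      r i (Sum.inl t) < r i (Sum.inl t') := by
    intro i t t' h
    have h1 := (e t).2
    have h2 : ((t.1 i : ℕ) + 1) * N ≤ (t'.1 i : ℕ) * N := Nat.mul_le_mul_right _ h
    simp only [r]
    nlinarith
  have hub : ∀ i (t : KGrid k n), r i (Sum.inl t) < (n + 1) * N + 1 := by
    intro i t
    have h1 := (e t).2
    have h2 : ((t.1 i : ℕ) + 1) * N ≤ (n + 1) * N := Nat.mul_le_mul_right _ (t.1 i).2
    simp only [r]
    nlinarith
  have h1 : ∀ i t, r i (Sum.inr i) < r i (Sum.inl t) := by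
    intro i t; simp [r]
  have h2 : ∀ i j t, j ≠ i → r i (Sum.inl t) < r i (Sum.inr j) := by
    intro i j t hj
    refine (hub i t).trans_le ?_
    simp [r, hj]
  have hr : ∀ i, Function.Injective (r i) := by
    rintro i (t | j) (t' | j') h
    · rcases lt_trichotomy (t.1 i : ℕ) (t'.1 i) with hlt | heq | hlt
      · exact absurd h (hmono i _ _ hlt).ne
      · simp only [r, heq] at h
        have : e t = e t' := Fin.ext (by omega)
        rw [e.injective this]
      · exact absurd h (hmono i _ _ hlt).ne'
    · by_cases hj : j' = i
      · subst hj; exact absurd h (h1 _ _).ne'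
      · exact absurd h (h2 _ _ _ hj).ne
    · by_cases hj : j = i
      · subst hj; exact absurd h (h1 _ _).ne
      · exact absurd h (h2 _ _ _ hj).ne'
    · simp only [r] at h
      congr 1
      apply Fin.ext
      split_ifs at h <;> first | omega | (subst_vars; rfl)
  obtain ⟨X, hD, hXc⟩ := kkm_scarf r hr h1 h2 c
  have hcol : ∀ i, Sum.inr i ∈ X ∨ ∃ t, Sum.inl t ∈ X ∧ c t = i := by
    intro i
    have : i ∈ X.image (Sum.elim c id) := by rw [hXc]; simp
    obtain ⟨t | j, hx, he⟩ := Finset.mem_image.1 this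
    · exact Or.inr ⟨t, hx, he⟩
    · simp only [Sum.elim_inr, id] at he
      exact Or.inl (he ▸ hx)
  have hT : ∃ t, Sum.inl t ∈ X := by
    obtain ⟨i, hi⟩ := hD (Sum.inl tt)
    rcases hcol i with h | ⟨t, h, -⟩
    · exact absurd (hi _ h) (not_le.2 (h1 i tt))
    · exact ⟨t, h⟩
  obtain ⟨t0, ht0⟩ := hT
  -- minima
  have hmin : ∀ i, ∃ t, Sum.inl t ∈ X ∧ ∀ t', Sum.inl t' ∈ X → (t.1 i : ℕ) ≤ t'.1 i := by
    intro i
    obtain ⟨t, ht, hm⟩ := Finset.exists_min_image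
      (Finset.univ.filter (fun t : KGrid k n => Sum.inl t ∈ X)) (fun t => (t.1 i : ℕ))
      ⟨t0, by simp [ht0]⟩
    simp only [Finset.mem_filter, Finset.mem_univ, true_and] at ht hm
    exact ⟨t, ht, hm⟩
  choose m hmX hm using hmin
  let g : Fin k → ℕ := fun i => if Sum.inr i ∈ X then 0 else (m i).1 i
  have hg : n < ∑ i, (g i + 1) := by
    by_contra! hle
    have hle' : ∑ i, (if Sum.inr i ∈ X then 0 else ((m i).1 i : ℕ) + 1) ≤ n := by
      refine le_trans (Finset.sum_le_sum fun i _ => ?_) hle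
      simp only [g]; split_ifs <;> omega
    obtain ⟨y, hy⟩ := kkm_grid_exists k n ⟨0, hk⟩ _ hle'
    obtain ⟨i, hi⟩ := hD (Sum.inl y)
    by_cases hiX : Sum.inr i ∈ X
    · exact absurd (hi _ hiX) (not_le.2 (h1 i y))
    · have := hy i
      rw [if_neg hiX] at this
      exact absurd (hi _ (hmX i)) (not_le.2 (hmono i _ _ this))
  have hg' : n < ∑ i, g i + k := by
    rw [Finset.sum_add_distrib] at hg; simpa using hg
  have hgle : ∀ t, Sum.inl t ∈ X → ∀ i, g i ≤ (t.1 i : ℕ) := by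
    intro t ht i
    simp only [g]; split_ifs
    · omega
    · exact hm i t ht
  have hgk : ∀ t, Sum.inl t ∈ X → ∀ i, (t.1 i : ℕ) ≤ g i + k := by
    intro t ht i
    have hs := t.2
    rw [← Finset.add_sum_erase _ _ (Finset.mem_univ i)] at hs hg'
    have := Finset.sum_le_sum (s := Finset.univ.erase i) fun j _ => hgle t ht j
    omega
  refine ⟨t0, fun i => ?_⟩
  rcases hcol i with h | ⟨t, h, hc⟩
  · left
    have := hgk t0 ht0 i
    simpa [g, h] using this
  · right
    refine ⟨t, hc, fun j => ?_⟩
    have := hgk t0 ht0 j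
    have := hgk t h j
    have := hgle t0 ht0 j
    have := hgle t h j
    omega

/-- Dual covering lemma: a closed cover has a point in all the sets indexed by its support. -/
lemma kkm_dual (k : ℕ) (hk : 0 < k) (B : Fin k → Set (Fin k → ℝ)) (hB : ∀ i, IsClosed (B i))
    (hcov : ∀ x ∈ stdSimplex ℝ (Fin k), ∃ i, x ∈ B i) :
    ∃ x ∈ stdSimplex ℝ (Fin k), ∀ i, x i = 0 ∨ x ∈ B i := by
  have hstep : ∀ n : ℕ, ∃ x ∈ stdSimplex ℝ (Fin k), ∀ i, x i ≤ k / ((n : ℝ) + 1) ∨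
      ∃ y ∈ B i, dist y x ≤ k / ((n : ℝ) + 1) := by
    intro n
    let p : KGrid k (n + 1) → (Fin k → ℝ) := fun t i => (t.1 i : ℕ) / ((n : ℝ) + 1)
    have hn : (0 : ℝ) < (n : ℝ) + 1 := by positivity
    have hp : ∀ t, p t ∈ stdSimplex ℝ (Fin k) := by
      intro t
      refine ⟨fun i => by positivity, ?_⟩
      simp only [p]
      rw [← Finset.sum_div, ← Nat.cast_sum, t.2]
      push_cast
      exact div_self hn.ne'
    choose c hc using fun t => hcov (p t) (hp t)
    obtain ⟨t0, ht0⟩ := kkm_grid k (n + 1) hk c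
    refine ⟨p t0, hp t0, fun i => ?_⟩
    rcases ht0 i with h | ⟨t, rfl, h⟩
    · left
      simp only [p]
      gcongr
    · right
      refine ⟨p t, hc t, ?_⟩
      rw [dist_pi_le_iff (by positivity)]
      intro j
      obtain ⟨ha, hb⟩ := h j
      have ha' : ((t.1 j : ℕ) : ℝ) ≤ (t0.1 j : ℕ) + k := by exact_mod_cast ha
      have hb' : ((t0.1 j : ℕ) : ℝ) ≤ (t.1 j : ℕ) + k := by exact_mod_cast hb
      simp only [p]
      rw [Real.dist_eq, ← sub_div, abs_div, abs_of_pos hn]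
      gcongr
      rw [abs_le]; constructor <;> linarith
  choose x hx hxi using hstep
  obtain ⟨z, hz, φ, hφ, hlim⟩ := (isCompact_stdSimplex ℝ (Fin k)).tendsto_subseq hx
  have h0 : Filter.Tendsto (fun n : ℕ => (k : ℝ) / ((n : ℝ) + 1)) Filter.atTop (nhds 0) :=
    by simpa [div_eq_mul_inv] using
      (tendsto_one_div_add_atTop_nhds_zero_nat (𝕜 := ℝ)).const_mul (k : ℝ)
  have h0' := h0.comp hφ.tendsto_atTop
  refine ⟨z, hz, fun i => ?_⟩
  by_contra! hcon
  obtain ⟨hzi, hzB⟩ := hcon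
  have hzpos : 0 < z i := lt_of_le_of_ne (hz.1 i) (Ne.symm hzi)
  obtain ⟨δ, hδ, hball⟩ := Metric.isOpen_iff.1 (hB i).isOpen_compl z hzB
  have e1 : ∀ᶠ n in Filter.atTop, (k : ℝ) / ((φ n : ℝ) + 1) < min (δ / 2) (z i / 2) :=
    h0'.eventually_lt_const (by positivity)
  have e2 : ∀ᶠ n in Filter.atTop, dist (x (φ n)) z < min (δ / 2) (z i / 2) :=
    (Metric.tendsto_nhds.1 hlim) _ (by positivity)
  obtain ⟨n, hn1, hn2⟩ := (e1.and e2).exists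
  rw [lt_min_iff] at hn1 hn2
  rcases hxi (φ n) i with h | ⟨y, hy, hd⟩
  · have := dist_le_pi_dist (x (φ n)) z i
    rw [Real.dist_eq, abs_le] at this
    linarith [this.1, hn1.2, hn2.2]
  · refine hball (a := y) ?_ hy
    rw [Metric.mem_ball]
    linarith [dist_triangle y (x (φ n)) z, hn1.1, hn2.1]

/-- The KKM theorem. -/
theorem kkm_theorem (k : ℕ) (hk : 0 < k) (A : Fin k → Set (Fin k → ℝ))
    (hclosed : ∀ i, IsClosed (A i))
    (hsub : ∀ i, A i ⊆ stdSimplex ℝ (Fin k))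
    (hcover : ∀ S : Finset (Fin k), S.Nonempty →
      ∀ x ∈ stdSimplex ℝ (Fin k), (∀ j, j ∉ S → x j = 0) → ∃ i ∈ S, x ∈ A i) :
    (⋂ i, A i).Nonempty := by
  classical
  have hne : ∀ i, (A i).Nonempty := by
    intro i
    obtain ⟨j, hj, hx⟩ := hcover {i} (by simp) (Pi.single i 1) (single_mem_stdSimplex ℝ i)
      (fun j hj => by
        have : j ≠ i := by simpa using hj
        simp [this])
    rw [Finset.mem_singleton] at hj
    exact ⟨_, hj ▸ hx⟩
  let d : Fin k → (Fin k → ℝ) → ℝ := fun i x => Metric.infDist x (A i)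
  have hd : ∀ i, Continuous (d i) := fun i => Metric.continuous_infDist_pt _
  have hd0 : ∀ i x, 0 ≤ d i x := fun i x => Metric.infDist_nonneg
  obtain ⟨x, hx, hxB⟩ := kkm_dual k hk (fun i => {x | x i * ∑ j, d j x ≤ d i x})
    (fun i => isClosed_le (by fun_prop) (hd i)) (by
      intro x hx
      by_contra! h
      simp only [Set.mem_ofPred_eq, not_le] at h
      have := Finset.sum_lt_sum_of_nonempty (s := Finset.univ) ⟨(⟨0, hk⟩ : Fin k), Finset.mem_univ _⟩
        fun i _ => h i
      rw [← Finset.sum_mul, hx.2, one_mul] at this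
      exact lt_irrefl _ this)
  have hall : ∀ i, x i * ∑ j, d j x ≤ d i x := by
    intro i
    rcases hxB i with h | h
    · rw [h, zero_mul]; exact hd0 i x
    · exact h
  have heq : ∀ i, x i * ∑ j, d j x = d i x := by
    have : ∑ i, x i * ∑ j, d j x = ∑ i, d i x := by
      rw [← Finset.sum_mul, hx.2, one_mul]
    have := (Finset.sum_eq_sum_iff_of_le fun i _ => hall i).1 this
    exact fun i => this i (Finset.mem_univ i)
  have hSne : (Finset.univ.filter (fun i => x i ≠ 0)).Nonempty := by
    by_contra hS
    rw [Finset.not_nonempty_iff_eq_empty, Finset.filter_eq_empty_iff] at hS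
    have h0 : ∑ i, x i = 0 := Finset.sum_eq_zero fun i hi => not_not.1 (hS hi)
    rw [hx.2] at h0
    exact one_ne_zero h0
  obtain ⟨i, hi, hxA⟩ := hcover _ hSne x hx (fun j hj => by simpa using hj)
  have hi0 : x i ≠ 0 := by simpa using hi
  have hsum : ∑ j, d j x = 0 := by
    have h := heq i
    have h' : d i x = 0 := Metric.infDist_zero_of_mem hxA
    rw [h'] at h
    exact (mul_eq_zero.1 h).resolve_left hi0
  refine ⟨x, Set.mem_iInter.2 fun j => ?_⟩
  have hj : d j x = 0 := by rw [← heq j, hsum, mul_zero]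
  exact ((hclosed j).mem_iff_infDist_zero (hne j)).2 hj
end

section
/- Let $n \geq k$ and suppose for each $i \in [n]$ we have closed sets $A^i_1,\dots,A^i_k \subseteq \Delta^{k-1}$ such that for every subset $I \subseteq [n]$ with $|I| = n-k+1$, the family $\big(\bigcup_{i\in I} A^i_1, \dots, \bigcup_{i\in I} A^i_k\big)$ is a KKM cover of $\Delta^{k-1}$. Then there exists an injection $\pi : [k] \to [n]$ such that $\bigcap_{j=1}^k A^{\pi(j)}_j \neq \emptyset$. -/
open Set

/-- `B` is a KKM cover of the standard simplex `Δ^{k-1}`. -/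
def IsKKMCover {k : ℕ} (B : Fin k → Set (Fin k → ℝ)) : Prop :=
  ∀ S : Finset (Fin k), S.Nonempty →
    ∀ x ∈ stdSimplex ℝ (Fin k), (∀ j, j ∉ S → x j = 0) → ∃ j ∈ S, x ∈ B j

/-- Dominance for a finite set with respect to a family of ranks. -/
def ScarfDom {U I : Type} (r : I → U → ℕ) (P : Finset U) : Prop :=
  ∀ y, ∃ i, ∀ x ∈ P, r i y ≤ r i x

lemma scarfDom_mono {U I : Type} {r : I → U → ℕ} {P Q : Finset U} (h : ScarfDom r P) (hQ : Q ⊆ P) :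
    ScarfDom r Q := fun y => let ⟨i, hi⟩ := h y; ⟨i, fun x hx => hi x (hQ hx)⟩

lemma scarf_min {U I : Type} (r : I → U → ℕ) (Q : Finset U) (hQ : Q.Nonempty) :
    ∃ m : I → U, ∀ i, m i ∈ Q ∧ ∀ q ∈ Q, r i (m i) ≤ r i q := by
  have : ∀ i, ∃ u, u ∈ Q ∧ ∀ q ∈ Q, r i u ≤ r i q := fun i => by
    obtain ⟨u, hu, h⟩ := Finset.exists_min_image Q (r i) hQ
    exact ⟨u, hu, h⟩
  choose m hm using this
  exact ⟨m, hm⟩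

/-- A non-special door is in exactly two rooms. -/
lemma scarf_two {U I : Type} [Fintype U] [DecidableEq U] [Fintype I] [DecidableEq I]
    (r : I → U → ℕ) (hr : ∀ i, Function.Injective (r i)) (s : I → U)
    (hs1 : ∀ i u, r i (s i) ≤ r i u)
    (hs2 : ∀ i j, j ≠ i → ∀ u, u ∉ range s → r i u < r i (s j))
    (hsi : Function.Injective s)
    (Q : Finset U) (hcard : Q.card + 1 = Fintype.card I) (hdom : ScarfDom r Q)
    (hT : ∃ u ∈ Q, u ∉ range s) :
    ∃ x y, x ≠ y ∧ x ∉ Q ∧ y ∉ Q ∧ ∀ z, z ∉ Q → (ScarfDom r (insert z Q) ↔ z = x ∨ z = y) := by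
  obtain ⟨u0, hu0, hu0s⟩ := hT
  obtain ⟨m, hm⟩ := scarf_min r Q ⟨u0, hu0⟩
  -- every element of `Q` is a minimum
  have hsurj : ∀ q ∈ Q, ∃ i, m i = q := by
    intro q hq
    obtain ⟨i, hi⟩ := hdom q
    exact ⟨i, hr i (le_antisymm ((hm i).2 q hq) (hi _ (hm i).1))⟩
  have hcol : ∃ a b, a ≠ b ∧ m a = m b := by
    obtain ⟨a, -, b, -, hab, h⟩ := Finset.exists_ne_map_eq_of_card_lt_of_maps_to
      (s := (Finset.univ : Finset I)) (t := Q) (f := m)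
      (by rw [Finset.card_univ]; omega) (fun i _ => (hm i).1)
    exact ⟨a, b, hab, h⟩
  obtain ⟨a, b, hab, hmab⟩ := hcol
  -- surjectivity even without `i ∈ {a, b}`
  have hsurj' : ∀ i, (i = a ∨ i = b) → ∀ q ∈ Q, ∃ e, e ≠ i ∧ m e = q := by
    intro i hi q hq
    obtain ⟨e, he⟩ := hsurj q hq
    by_cases hei : e = i
    · rcases hi with rfl | rfl
      · exact ⟨b, hab.symm, by rw [← hmab, ← hei, he]⟩
      · exact ⟨a, hab, by rw [hmab, ← hei, he]⟩
    · exact ⟨e, hei, he⟩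
  have hx : ∀ i, ∃ x, (∀ e, e ≠ i → r e (m e) < r e x) ∧
      ∀ y, (∀ e, e ≠ i → r e (m e) < r e y) → r i y ≤ r i x := by
    intro i
    have hne : (Finset.univ.filter (fun x => ∀ e, e ≠ i → r e (m e) < r e x)).Nonempty := by
      refine ⟨s i, ?_⟩
      simp only [Finset.mem_filter, Finset.mem_univ, true_and]
      intro e he
      exact lt_of_le_of_lt ((hm e).2 u0 hu0) (hs2 e i he.symm u0 hu0s)
    obtain ⟨x, hx, h⟩ := Finset.exists_max_image _ (r i) hne
    simp only [Finset.mem_filter, Finset.mem_univ, true_and] at hx h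
    exact ⟨x, hx, h⟩
  choose X hX1 hX2 using hx
  have hXQ : ∀ i, (i = a ∨ i = b) → X i ∉ Q := by
    intro i hi hq
    obtain ⟨e, he, h⟩ := hsurj' i hi _ hq
    have := hX1 i e he
    rw [h] at this
    exact lt_irrefl _ this
  have hXle : ∀ i, ∀ q ∈ Q, r i (X i) ≤ r i q := by
    intro i
    obtain ⟨e, he⟩ := hdom (X i)
    by_cases hei : e = i
    · subst hei; exact he
    · exact absurd (he _ (hm e).1) (not_le.2 (hX1 i e hei))
  refine ⟨X a, X b, ?_, hXQ a (Or.inl rfl), hXQ b (Or.inr rfl), ?_⟩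
  · intro h
    have h1 := hX1 a b hab.symm
    rw [h] at h1
    exact absurd (hXle b _ (hm b).1) (not_le.2 h1)
  · intro z hz
    constructor
    · intro hd
      obtain ⟨m', hm'⟩ := scarf_min r (insert z Q) ⟨z, Finset.mem_insert_self _ _⟩
      have hs' : ∀ q ∈ insert z Q, ∃ i, m' i = q := by
        intro q hq
        obtain ⟨i, hi⟩ := hd q
        exact ⟨i, hr i (le_antisymm ((hm' i).2 q hq) (hi _ (hm' i).1))⟩
      have hinj : Function.Injective m' := by
        have h1 : Finset.univ.image m' = insert z Q := by
          ext q
          simp only [Finset.mem_image, Finset.mem_univ, true_and]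
          exact ⟨fun ⟨i, hi⟩ => hi ▸ (hm' i).1, hs' q⟩
        have h2 : (Finset.univ.image m').card = (Finset.univ : Finset I).card := by
          rw [h1, Finset.card_insert_of_notMem hz, hcard, Finset.card_univ]
        have := Finset.card_image_iff.1 h2
        exact fun x y h => this (by simp) (by simp) h
      obtain ⟨i, hi⟩ := hs' z (Finset.mem_insert_self _ _)
      have hmm : ∀ e, e ≠ i → m' e = m e := by
        intro e he
        have h1 : m' e ∈ Q := by
          rcases Finset.mem_insert.1 (hm' e).1 with h | h
          · exact absurd (hinj (h.trans hi.symm)) he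
          · exact h
        exact hr e (le_antisymm ((hm' e).2 _ (Finset.mem_insert_of_mem (hm e).1)) ((hm e).2 _ h1))
      have hiab : i = a ∨ i = b := by
        by_contra hcon
        push Not at hcon
        apply hab
        apply hinj
        rw [hmm a hcon.1.symm, hmm b hcon.2.symm, hmab]
      have hzY : ∀ e, e ≠ i → r e (m e) < r e z := by
        intro e he
        rw [← hmm e he]
        refine lt_of_le_of_ne ((hm' e).2 z (Finset.mem_insert_self _ _)) ?_
        intro h
        exact he (hinj ((hr e h).trans hi.symm))
      have hzX : z = X i := by
        apply hr i
        apply le_antisymm (hX2 i z hzY)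
        obtain ⟨e, he⟩ := hd (X i)
        by_cases hei : e = i
        · subst hei; exact he z (Finset.mem_insert_self _ _)
        · exact absurd (he _ (Finset.mem_insert_of_mem (hm e).1)) (not_le.2 (hX1 i e hei))
      rcases hiab with rfl | rfl
      · exact Or.inl hzX
      · exact Or.inr hzX
    · intro h
      obtain ⟨i, rfl⟩ : ∃ i, z = X i := by
        rcases h with h | h
        · exact ⟨a, h⟩
        · exact ⟨b, h⟩
      intro y
      by_cases hy : ∀ e, e ≠ i → r e (m e) < r e y
      · refine ⟨i, fun x hx => ?_⟩
        rcases Finset.mem_insert.1 hx with rfl | hx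
        · exact hX2 i y hy
        · exact (hX2 i y hy).trans (hXle i x hx)
      · push Not at hy
        obtain ⟨e, he, hle⟩ := hy
        refine ⟨e, fun x hx => ?_⟩
        rcases Finset.mem_insert.1 hx with rfl | hx
        · exact hle.trans (hX1 i e he).le
        · exact hle.trans ((hm e).2 x hx)

/-- The special door is in exactly one room. -/
lemma scarf_one {U I : Type} [Fintype U] [DecidableEq U] [Fintype I] [DecidableEq I]
    (r : I → U → ℕ) (hr : ∀ i, Function.Injective (r i)) (s : I → U)
    (hs1 : ∀ i u, r i (s i) ≤ r i u)
    (hs2 : ∀ i j, j ≠ i → ∀ u, u ∉ range s → r i u < r i (s j))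
    (hsi : Function.Injective s) (i0 : I) (Q : Finset U)
    (hQ : Q = (Finset.univ.erase i0).image s) :
    ∃ x, x ∉ Q ∧ ∀ z, z ∉ Q → (ScarfDom r (insert z Q) ↔ z = x) := by
  have hQm : ∀ u, u ∈ Q ↔ ∃ j, j ≠ i0 ∧ s j = u := by
    intro u; rw [hQ]; simp
  have hle : ∀ y, y ∉ Q → ∀ q ∈ Q, r i0 y ≤ r i0 q := by
    intro y hy q hq
    obtain ⟨j, hj, rfl⟩ := (hQm q).1 hq
    by_cases hys : y ∈ range s
    · obtain ⟨e, rfl⟩ := hys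
      have : e = i0 := by
        by_contra h
        exact hy ((hQm _).2 ⟨e, h, rfl⟩)
      subst this
      exact hs1 _ _
    · exact (hs2 i0 j hj y hys).le
  have hne : (Finset.univ.filter (fun x => x ∉ Q)).Nonempty := by
    refine ⟨s i0, ?_⟩
    simp only [Finset.mem_filter, Finset.mem_univ, true_and, hQm]
    rintro ⟨j, hj, h⟩
    exact hj (hsi h)
  obtain ⟨x, hx, hmax⟩ := Finset.exists_max_image _ (r i0) hne
  simp only [Finset.mem_filter, Finset.mem_univ, true_and] at hx hmax
  refine ⟨x, hx, fun z hz => ⟨fun hd => ?_, ?_⟩⟩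
  · apply hr i0
    apply le_antisymm (hmax z hz)
    obtain ⟨i, hi⟩ := hd x
    by_cases h : i = i0
    · subst h; exact hi z (Finset.mem_insert_self _ _)
    · exfalso
      have hsQ : s i ∈ Q := (hQm _).2 ⟨i, h, rfl⟩
      have := hr i (le_antisymm (hi (s i) (Finset.mem_insert_of_mem hsQ)) (hs1 i x))
      exact hx (this ▸ hsQ)
  · rintro rfl y
    by_cases hy : y ∈ Q
    · obtain ⟨j, hj, rfl⟩ := (hQm y).1 hy
      exact ⟨j, fun x _ => hs1 j x⟩
    · refine ⟨i0, fun x hx => ?_⟩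
      rcases Finset.mem_insert.1 hx with rfl | hx
      · exact hmax y hy
      · exact hle y hy x hx

/-- Non-colourful rooms have an even number of doors. -/
lemma scarf_even {U I : Type} [Fintype U] [DecidableEq U] [Fintype I] [DecidableEq I]
    (c : U → I) (i0 : I) (P : Finset U) (hcard : P.card = Fintype.card I)
    (hP : P.image c ≠ Finset.univ) (S : Finset (Finset U))
    (hS : ∀ Q, Q ∈ S ↔ Q ⊆ P ∧ Q.card + 1 = Fintype.card I ∧
      Q.image c = Finset.univ.erase i0) : Even S.card := by
  rcases S.eq_empty_or_nonempty with h | ⟨Q, hQ⟩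
  · simp [h]
  obtain ⟨hQP, hQc, hQi⟩ := (hS Q).1 hQ
  obtain ⟨x1, hx1, hPx⟩ : ∃ x, x ∉ Q ∧ P = insert x Q := by
    have : (P \ Q).card = 1 := by
      rw [Finset.card_sdiff_of_subset hQP]; omega
    obtain ⟨x, hx⟩ := Finset.card_eq_one.1 this
    have hxm : x ∈ P \ Q := by rw [hx]; simp
    refine ⟨x, (Finset.mem_sdiff.1 hxm).2, ?_⟩
    ext y
    have := Finset.ext_iff.1 hx y
    simp only [Finset.mem_sdiff, Finset.mem_singleton] at this
    simp only [Finset.mem_insert]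
    have := @hQP y
    tauto
  have hinj : Set.InjOn c Q := by
    apply Finset.card_image_iff.1
    rw [hQi, Finset.card_erase_of_mem (Finset.mem_univ _), Finset.card_univ]; omega
  have hcx : c x1 ≠ i0 := by
    intro h
    apply hP
    rw [hPx, Finset.image_insert, hQi, h, Finset.insert_erase (Finset.mem_univ _)]
  have : c x1 ∈ Q.image c := by rw [hQi]; simp [hcx]
  obtain ⟨x2, hx2, hc2⟩ := Finset.mem_image.1 this
  have h12 : x1 ≠ x2 := fun h => hx1 (h ▸ hx2)
  have hSeq : S = {Q, P.erase x2} := by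
    ext R
    rw [hS]
    simp only [Finset.mem_insert, Finset.mem_singleton]
    constructor
    · rintro ⟨hRP, hRc, hRi⟩
      have hinjR : Set.InjOn c R := by
        apply Finset.card_image_iff.1
        rw [hRi, Finset.card_erase_of_mem (Finset.mem_univ _), Finset.card_univ]; omega
      by_cases hx1R : x1 ∈ R
      · right
        have hx2R : x2 ∉ R := fun h => h12 (hinjR hx1R h hc2.symm)
        apply Finset.eq_of_subset_of_card_le
        · intro y hy
          exact Finset.mem_erase.2 ⟨fun h => hx2R (h ▸ hy), hRP hy⟩
        · rw [Finset.card_erase_of_mem (hQP hx2)]; omega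
      · left
        apply Finset.eq_of_subset_of_card_le
        · intro y hy
          have := hRP hy
          rw [hPx, Finset.mem_insert] at this
          rcases this with rfl | h
          · exact absurd hy hx1R
          · exact h
        · omega
    · rintro (rfl | rfl)
      · exact ⟨hQP, hQc, hQi⟩
      · refine ⟨Finset.erase_subset _ _, ?_, ?_⟩
        · rw [Finset.card_erase_of_mem (hQP hx2)]
          have := Finset.card_pos.2 ⟨x2, hQP hx2⟩
          omega
        · rw [← hQi]
          ext j
          simp only [Finset.mem_image, Finset.mem_erase]
          constructor
          · rintro ⟨y, ⟨hy2, hyP⟩, rfl⟩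
            rw [hPx, Finset.mem_insert] at hyP
            rcases hyP with rfl | h
            · exact ⟨x2, hx2, hc2⟩
            · exact ⟨y, h, rfl⟩
          · rintro ⟨y, hy, rfl⟩
            by_cases h : y = x2
            · subst h
              exact ⟨x1, ⟨h12, hPx ▸ Finset.mem_insert_self _ _⟩, hc2.symm⟩
            · exact ⟨y, ⟨h, hQP hy⟩, rfl⟩
  rw [hSeq, Finset.card_pair]
  · exact even_two
  · intro h
    rw [h] at hx2
    simp at hx2

/-- Scarf's combinatorial lemma. -/
lemma scarf_main {U I : Type} [Fintype U] [DecidableEq U] [Fintype I] [DecidableEq I]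
    (r : I → U → ℕ) (hr : ∀ i, Function.Injective (r i)) (s : I → U)
    (hs1 : ∀ i u, r i (s i) ≤ r i u)
    (hs2 : ∀ i j, j ≠ i → ∀ u, u ∉ range s → r i u < r i (s j))
    (c : U → I) (hcs : ∀ i, c (s i) = i) (i0 : I) :
    ∃ P : Finset U, P.card = Fintype.card I ∧ ScarfDom r P ∧ P.image c = Finset.univ := by
  classical
  have hsi : Function.Injective s := fun a b h => by rw [← hcs a, h, hcs b]
  by_contra hcon
  push Not at hcon
  let rooms : Finset (Finset U) :=
    Finset.univ.filter (fun P => P.card = Fintype.card I ∧ ScarfDom r P)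
  let doors : Finset (Finset U) :=
    Finset.univ.filter (fun Q => Q.card + 1 = Fintype.card I ∧ ScarfDom r Q ∧
      Q.image c = Finset.univ.erase i0)
  have hdc := Finset.sum_card_bipartiteAbove_eq_sum_card_bipartiteBelow
    (s := doors) (t := rooms) (fun Q P => Q ⊆ P)
  have heven : Even (∑ P ∈ rooms, (Finset.bipartiteBelow (fun Q P => Q ⊆ P) doors P).card) := by
    apply Finset.even_sum
    intro P hP
    simp only [rooms, Finset.mem_filter, Finset.mem_univ, true_and] at hP
    apply scarf_even c i0 P hP.1 (hcon P hP.1 hP.2)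
    intro Q
    simp only [Finset.bipartiteBelow, doors, Finset.mem_filter, Finset.mem_univ, true_and]
    constructor
    · rintro ⟨⟨h1, h2, h3⟩, h4⟩
      exact ⟨h4, h1, h3⟩
    · rintro ⟨h4, h1, h3⟩
      exact ⟨⟨h1, scarfDom_mono hP.2 h4, h3⟩, h4⟩
  let Q0 : Finset U := (Finset.univ.erase i0).image s
  -- description of the rooms above a door
  have habove : ∀ Q ∈ doors, Finset.bipartiteAbove (fun Q P => Q ⊆ P) rooms Q =
      (Finset.univ.filter (fun z => z ∉ Q ∧ ScarfDom r (insert z Q))).image (fun z => insert z Q) := by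
    intro Q hQ
    simp only [doors, Finset.mem_filter, Finset.mem_univ, true_and] at hQ
    ext P
    simp only [Finset.bipartiteAbove, rooms, Finset.mem_filter, Finset.mem_univ, true_and,
      Finset.mem_image]
    constructor
    · rintro ⟨⟨hPc, hPd⟩, hQP⟩
      have : (P \ Q).card = 1 := by
        rw [Finset.card_sdiff_of_subset hQP]; omega
      obtain ⟨x, hx⟩ := Finset.card_eq_one.1 this
      have hxm : x ∈ P \ Q := by rw [hx]; simp
      have hPx : insert x Q = P := by
        ext y
        have := Finset.ext_iff.1 hx y
        simp only [Finset.mem_sdiff, Finset.mem_singleton] at this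
        simp only [Finset.mem_insert]
        have := @hQP y
        tauto
      exact ⟨x, ⟨(Finset.mem_sdiff.1 hxm).2, hPx ▸ hPd⟩, hPx⟩
    · rintro ⟨z, ⟨hz, hd⟩, rfl⟩
      refine ⟨⟨?_, hd⟩, Finset.subset_insert _ _⟩
      rw [Finset.card_insert_of_notMem hz, hQ.1]
  have hcardabove : ∀ Q ∈ doors, (Finset.bipartiteAbove (fun Q P => Q ⊆ P) rooms Q).card =
      (Finset.univ.filter (fun z => z ∉ Q ∧ ScarfDom r (insert z Q))).card := by
    intro Q hQ
    rw [habove Q hQ]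
    apply Finset.card_image_of_injOn
    intro x hx y hy h
    simp only [Finset.coe_filter, Finset.mem_univ, true_and, Set.mem_ofPred_eq] at hx hy
    have : x ∈ insert y Q := by
      have h' : insert x Q = insert y Q := h
      rw [← h']; exact Finset.mem_insert_self _ _
    rcases Finset.mem_insert.1 this with h | h
    · exact h
    · exact absurd h hx.1
  have hQ0 : Q0 ∈ doors := by
    simp only [doors, Finset.mem_filter, Finset.mem_univ, true_and]
    refine ⟨?_, ?_, ?_⟩
    · rw [Finset.card_image_of_injective _ hsi, Finset.card_erase_of_mem (Finset.mem_univ _),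
        Finset.card_univ]
      have : 0 < Fintype.card I := Fintype.card_pos_iff.2 ⟨i0⟩
      omega
    · obtain ⟨x, hx, h⟩ := scarf_one r hr s hs1 hs2 hsi i0 Q0 rfl
      exact scarfDom_mono ((h x hx).2 rfl) (Finset.subset_insert _ _)
    · rw [Finset.image_image]
      have : c ∘ s = id := funext hcs
      rw [this, Finset.image_id]
  have hodd : Odd (∑ Q ∈ doors, (Finset.bipartiteAbove (fun Q P => Q ⊆ P) rooms Q).card) := by
    rw [← Finset.add_sum_erase _ _ hQ0]
    apply Odd.add_even
    · rw [hcardabove _ hQ0]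
      obtain ⟨x, hx, h⟩ := scarf_one r hr s hs1 hs2 hsi i0 Q0 rfl
      have : Finset.univ.filter (fun z => z ∉ Q0 ∧ ScarfDom r (insert z Q0)) = {x} := by
        ext z
        simp only [Finset.mem_filter, Finset.mem_univ, true_and, Finset.mem_singleton]
        constructor
        · rintro ⟨h1, h2⟩; exact (h z h1).1 h2
        · rintro rfl; exact ⟨hx, (h z hx).2 rfl⟩
      rw [this]; simp
    · apply Finset.even_sum
      intro Q hQ
      obtain ⟨hQne, hQd⟩ := Finset.mem_erase.1 hQ
      rw [hcardabove _ hQd]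
      simp only [doors, Finset.mem_filter, Finset.mem_univ, true_and] at hQd
      obtain ⟨hc1, hd, hi⟩ := hQd
      have hT : ∃ u ∈ Q, u ∉ range s := by
        by_contra hno
        push Not at hno
        apply hQne
        apply Finset.eq_of_subset_of_card_le
        · intro u hu
          obtain ⟨j, rfl⟩ := hno u hu
          have : c (s j) ∈ Q.image c := Finset.mem_image_of_mem _ hu
          rw [hi, hcs] at this
          exact Finset.mem_image_of_mem _ this
        · rw [Finset.card_image_of_injective _ hsi, Finset.card_erase_of_mem (Finset.mem_univ _),
            Finset.card_univ]
          omega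
      obtain ⟨x, y, hxy, hx, hy, h⟩ := scarf_two r hr s hs1 hs2 hsi Q hc1 hd hT
      have : Finset.univ.filter (fun z => z ∉ Q ∧ ScarfDom r (insert z Q)) = {x, y} := by
        ext z
        simp only [Finset.mem_filter, Finset.mem_univ, true_and, Finset.mem_singleton,
          Finset.mem_insert]
        constructor
        · rintro ⟨h1, h2⟩; exact (h z h1).1 h2
        · intro hz
          have hzQ : z ∉ Q := by rcases hz with rfl | rfl <;> assumption
          exact ⟨hzQ, (h z hzQ).2 hz⟩
      rw [this, Finset.card_pair hxy]
      exact even_two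
  rw [hdc] at hodd
  exact (Nat.not_even_iff_odd.2 hodd) heven

lemma grid_lemma (k N : ℕ) (hk : 0 < k)
    (c : {t : Fin k → Fin (N + 1) // ∑ i, (t i : ℕ) = N} → Fin k) :
    ∃ C : Finset (Fin k), C.Nonempty ∧
      ∃ t : Fin k → {t : Fin k → Fin (N + 1) // ∑ i, (t i : ℕ) = N},
        (∀ i ∈ C, c (t i) = i) ∧
        (∀ i ∈ C, ∀ i' ∈ C, ∀ j, ((t i).1 j : ℕ) < (t i').1 j + k) ∧
        (∀ i ∈ C, ∀ j, j ∉ C → ((t i).1 j : ℕ) < k) := by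
  classical
  let T := {t : Fin k → Fin (N + 1) // ∑ i, (t i : ℕ) = N}
  let U := T ⊕ Fin k
  let M := Fintype.card U
  let e : U ≃ Fin M := Fintype.equivFin U
  let w : Fin k → U → ℕ := fun i u =>
    Sum.elim (fun t : T => (t.1 i : ℕ) + 1) (fun j => if j = i then 0 else N + 2) u
  let r : Fin k → U → ℕ := fun i u => M * w i u + (e u : ℕ)
  have hlt : ∀ i u v, w i u < w i v → r i u < r i v := by
    intro i u v h
    have h1 : M * (w i u + 1) ≤ M * w i v := Nat.mul_le_mul_left _ h
    have h2 := (e u).2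
    simp only [r]
    rw [Nat.mul_add] at h1
    omega
  have hle : ∀ i u v, r i u ≤ r i v → w i u ≤ w i v := by
    intro i u v h
    by_contra hc
    exact absurd (hlt i v u (not_le.1 hc)) (not_lt.2 h)
  have hr : ∀ i, Function.Injective (r i) := by
    intro i u v h
    have h1 : w i u = w i v := le_antisymm (hle i u v h.le) (hle i v u h.ge)
    have h2 : M * w i u + (e u : ℕ) = M * w i v + (e v : ℕ) := h
    rw [h1] at h2
    exact e.injective (Fin.ext (by omega))
  have hwpos : ∀ i u, u ≠ Sum.inr i → 0 < w i u := by
    intro i u hu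
    rcases u with t | j
    · simp [w]
    · have : j ≠ i := fun h => hu (by rw [h])
      simp [w, this]
  have hw0 : ∀ i, w i (Sum.inr i) = 0 := by intro i; simp [w]
  obtain ⟨P, hPc, hPd, hPi⟩ := scarf_main r hr (fun i => (Sum.inr i : U))
    (by
      intro i u
      by_cases h : u = Sum.inr i
      · rw [h]
      · exact (hlt i _ _ (by rw [hw0]; exact hwpos i u h)).le)
    (by
      intro i j hj u hu
      rcases u with t | l
      · apply hlt
        have := (t.1 i).2
        simp only [w, Sum.elim_inl, Sum.elim_inr, if_neg hj]
        omega
      · exact absurd ⟨l, rfl⟩ hu)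
    (Sum.elim c id) (fun i => rfl) ⟨0, hk⟩
  let C : Finset (Fin k) := Finset.univ.filter (fun i => (Sum.inr i : U) ∉ P)
  have hC : ∀ i, i ∈ C ↔ (Sum.inr i : U) ∉ P := by intro i; simp [C]
  have hdomT : ∀ y : T, ∃ i ∈ C, ∀ t : T, (Sum.inl t : U) ∈ P → (y.1 i : ℕ) ≤ t.1 i := by
    intro y
    obtain ⟨i, hi⟩ := hPd (Sum.inl y)
    refine ⟨i, (hC i).2 fun h => ?_, fun t ht => ?_⟩
    · have := hle _ _ _ (hi _ h)
      rw [hw0] at this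
      have := hwpos i (Sum.inl y) (by simp)
      omega
    · have := hle _ _ _ (hi _ ht)
      simpa [w] using this
  have hcol : ∀ i ∈ C, ∃ t : T, (Sum.inl t : U) ∈ P ∧ c t = i := by
    intro i hi
    have : i ∈ P.image (Sum.elim c id) := by rw [hPi]; simp
    obtain ⟨u, hu, hci⟩ := Finset.mem_image.1 this
    rcases u with t | j
    · exact ⟨t, hu, hci⟩
    · have : j = i := hci
      subst this
      exact absurd hu ((hC _).1 hi)
  -- a point of the grid
  let y0 : T := ⟨fun i => if i = ⟨0, hk⟩ then Fin.last N else 0, by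
    simp [apply_ite (fun z : Fin (N + 1) => (z : ℕ))]⟩
  have hCne : C.Nonempty := by
    obtain ⟨i, hi, -⟩ := hdomT y0
    exact ⟨i, hi⟩
  let σ : Finset T := Finset.univ.filter (fun t => (Sum.inl t : U) ∈ P)
  have hσ : ∀ t, t ∈ σ ↔ (Sum.inl t : U) ∈ P := by intro t; simp [σ]
  have hσne : σ.Nonempty := by
    obtain ⟨i, hi⟩ := hCne
    obtain ⟨t, ht, -⟩ := hcol i hi
    exact ⟨t, (hσ t).2 ht⟩
  have hmin : ∀ i, ∃ m : ℕ, (∀ t ∈ σ, m ≤ t.1 i) ∧ ∃ t ∈ σ, (t.1 i : ℕ) = m := by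
    intro i
    obtain ⟨t, ht, h⟩ := Finset.exists_min_image σ (fun t => (t.1 i : ℕ)) hσne
    exact ⟨t.1 i, h, t, ht, rfl⟩
  choose m hm1 hm2 using hmin
  have hsum : N < ∑ i ∈ C, m i + k := by
    by_contra hcon
    push Not at hcon
    have hCk : C.card ≤ k := by simpa using Finset.card_le_univ C
    have h1 : ∑ i ∈ C, (m i + 1) ≤ N := by
      rw [Finset.sum_add_distrib]; simp; omega
    obtain ⟨i1, hi1⟩ := hCne
    let y : Fin k → ℕ := fun i => (if i ∈ C then m i + 1 else 0) +
      (if i = i1 then N - ∑ i ∈ C, (m i + 1) else 0)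
    have hysum : ∑ i, y i = N := by
      simp only [y]
      rw [Finset.sum_add_distrib, Finset.sum_ite_mem, Finset.univ_inter, Finset.sum_ite_eq']
      simp only [Finset.mem_univ, if_true]
      omega
    have hyle : ∀ i, y i ≤ N := by
      intro i
      rw [← hysum]
      exact Finset.single_le_sum (f := y) (fun _ _ => Nat.zero_le _) (Finset.mem_univ i)
    obtain ⟨i, hi, h⟩ := hdomT ⟨fun i => ⟨y i, by have := hyle i; omega⟩, by simpa using hysum⟩
    obtain ⟨t, ht, hti⟩ := hm2 i
    have := h t ((hσ t).1 ht)
    simp only [y, hi, if_true] at this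
    omega
  have hT : ∀ t ∈ σ, (∀ i ∈ C, (t.1 i : ℕ) < m i + k) ∧ ∀ j, j ∉ C → (t.1 j : ℕ) < k := by
    intro t ht
    constructor
    · intro i hi
      have h1 : ∑ j ∈ C, (t.1 j : ℕ) ≤ N := by
        conv_rhs => rw [← t.2]
        exact Finset.sum_le_sum_of_subset (Finset.subset_univ _)
      rw [← Finset.add_sum_erase _ _ hi] at h1 hsum
      have h2 : ∑ j ∈ C.erase i, m j ≤ ∑ j ∈ C.erase i, (t.1 j : ℕ) :=
        Finset.sum_le_sum fun j _ => hm1 j t ht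
      omega
    · intro j hj
      have h1 : ∑ l ∈ insert j C, (t.1 l : ℕ) ≤ N := by
        conv_rhs => rw [← t.2]
        exact Finset.sum_le_sum_of_subset (Finset.subset_univ _)
      rw [Finset.sum_insert hj] at h1
      have h2 : ∑ j ∈ C, m j ≤ ∑ j ∈ C, (t.1 j : ℕ) :=
        Finset.sum_le_sum fun j _ => hm1 j t ht
      omega
  have hch : ∀ i, ∃ t : T, i ∈ C → t ∈ σ ∧ c t = i := by
    intro i
    by_cases hi : i ∈ C
    · obtain ⟨t, h1, h2⟩ := hcol i hi
      exact ⟨t, fun _ => ⟨(hσ t).2 h1, h2⟩⟩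
    · exact ⟨y0, fun h => absurd h hi⟩
  choose t ht using hch
  refine ⟨C, hCne, t, fun i hi => (ht i hi).2, ?_, ?_⟩
  · intro i hi i' hi' j
    by_cases hj : j ∈ C
    · have h1 := (hT _ (ht i hi).1).1 j hj
      have h2 := hm1 j _ (ht i' hi').1
      omega
    · have h1 := (hT _ (ht i hi).1).2 j hj
      omega
  · intro i hi j hj
    exact (hT _ (ht i hi).1).2 j hj

lemma limit_lemma {α ι E : Type} [Finite α] [MetricSpace E] (K : Set E) (hK : IsCompact K)
    (B : α → ι → Set E) (hB : ∀ a j, IsClosed (B a j))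
    (h : ∀ ε > (0 : ℝ), ∃ a, ∃ x ∈ K, ∀ j, ∃ q ∈ B a j, dist q x ≤ ε) :
    ∃ a, ∃ x ∈ K, ∀ j, x ∈ B a j := by
  have h1 : ∃ a, ∀ ε > (0 : ℝ), ∃ x ∈ K, ∀ j, ∃ q ∈ B a j, dist q x ≤ ε := by
    by_contra hcon
    push Not at hcon
    choose ε hε hno using hcon
    obtain ⟨a0, -⟩ := h 1 one_pos
    have : Nonempty α := ⟨a0⟩
    obtain ⟨b, hb⟩ := Finite.exists_min ε
    obtain ⟨a, x, hx, hq⟩ := h (ε b) (hε b)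
    obtain ⟨j, hj⟩ := hno a x hx
    obtain ⟨q, hqB, hd⟩ := hq j
    exact absurd (hd.trans (hb a)) (not_le.2 (hj q hqB))
  obtain ⟨a, ha⟩ := h1
  have h2 : ∀ n : ℕ, ∃ x ∈ K, ∀ j, ∃ q ∈ B a j, dist q x ≤ 1 / ((n : ℝ) + 1) := fun n =>
    ha _ (by positivity)
  choose x hxK hx using h2
  obtain ⟨y, hy, φ, hφ, hlim⟩ := hK.tendsto_subseq hxK
  refine ⟨a, y, hy, fun j => ?_⟩
  choose q hqB hq using fun n => hx n j
  refine (hB a j).mem_of_tendsto (f := fun n => q (φ n)) (b := Filter.atTop) ?_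
    (Filter.Eventually.of_forall fun n => hqB _)
  refine tendsto_iff_dist_tendsto_zero.2 ?_
  have h3 : Filter.Tendsto (fun n => 1 / ((φ n : ℝ) + 1) + dist (x (φ n)) y) Filter.atTop
      (nhds (0 + 0)) := by
    apply Filter.Tendsto.add
    · exact tendsto_one_div_add_atTop_nhds_zero_nat.comp hφ.tendsto_atTop
    · exact tendsto_iff_dist_tendsto_zero.1 hlim
  rw [add_zero] at h3
  refine squeeze_zero (fun _ => dist_nonneg) (fun n => ?_) h3
  exact (dist_triangle _ (x (φ n)) _).trans (by gcongr; exact hq _)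

lemma dual_kkm (k : ℕ) (hk : 0 < k) (D : Fin k → Set (Fin k → ℝ)) (hD : ∀ i, IsClosed (D i))
    (hcov : ∀ x ∈ stdSimplex ℝ (Fin k), ∃ i, x ∈ D i) :
    ∃ x ∈ stdSimplex ℝ (Fin k), ∃ C : Finset (Fin k), (∀ i ∈ C, x ∈ D i) ∧
      ∀ i, i ∉ C → x i = 0 := by
  classical
  obtain ⟨C, x, hx, h⟩ := limit_lemma (α := Finset (Fin k)) (ι := Fin k)
    (stdSimplex ℝ (Fin k)) (isCompact_stdSimplex ℝ (Fin k))
    (fun C j => if j ∈ C then D j else {x | x j = 0})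
    (by
      intro C j
      split_ifs
      · exact hD j
      · exact isClosed_eq (continuous_apply j) continuous_const)
    (by
      intro ε hε
      obtain ⟨N, hN⟩ := exists_nat_gt ((k : ℝ) / ε)
      have hkpos : (0 : ℝ) < k := by exact_mod_cast hk
      have hNpos : (0 : ℝ) < N := lt_trans (by positivity) hN
      have hkN : (k : ℝ) ≤ ε * N := by
        rw [div_lt_iff₀ hε] at hN
        linarith
      let T := {t : Fin k → Fin (N + 1) // ∑ i, (t i : ℕ) = N}
      let p : T → Fin k → ℝ := fun t i => ((t.1 i : ℕ) : ℝ) / N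
      have hp : ∀ t, p t ∈ stdSimplex ℝ (Fin k) := by
        intro t
        refine ⟨fun i => by positivity, ?_⟩
        simp only [p]
        rw [← Finset.sum_div, ← Nat.cast_sum, t.2, div_self hNpos.ne']
      choose c hc using fun t => hcov (p t) (hp t)
      obtain ⟨C, ⟨i0, hi0⟩, t, h1, h2, h3⟩ := grid_lemma k N hk c
      refine ⟨C, p (t i0), hp _, fun j => ?_⟩
      by_cases hj : j ∈ C
      · simp only [hj, if_true]
        refine ⟨p (t j), ?_, ?_⟩
        · have := hc (t j)
          rwa [h1 j hj] at this
        · refine (dist_pi_le_iff hε.le).2 fun l => ?_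
          rw [Real.dist_eq]
          simp only [p]
          rw [← sub_div, abs_div, abs_of_pos hNpos, div_le_iff₀ hNpos]
          have e1 := h2 j hj i0 hi0 l
          have e2 := h2 i0 hi0 j hj l
          have e1' : (((t j).1 l : ℕ) : ℝ) ≤ ((t i0).1 l : ℕ) + k := by exact_mod_cast e1.le
          have e2' : (((t i0).1 l : ℕ) : ℝ) ≤ ((t j).1 l : ℕ) + k := by exact_mod_cast e2.le
          rw [abs_le]
          constructor <;> linarith
      · simp only [hj, if_false]
        refine ⟨Function.update (p (t i0)) j 0, by simp, ?_⟩
        refine (dist_pi_le_iff hε.le).2 fun l => ?_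
        by_cases hl : l = j
        · subst hl
          rw [Function.update_self, Real.dist_eq, zero_sub, abs_neg]
          simp only [p]
          rw [abs_div, abs_of_pos hNpos, div_le_iff₀ hNpos, Nat.abs_cast]
          have e1 := h3 i0 hi0 l hj
          have e1' : (((t i0).1 l : ℕ) : ℝ) ≤ k := by exact_mod_cast e1.le
          linarith
        · rw [Function.update_of_ne hl, dist_self]
          exact hε.le)
  refine ⟨x, hx, C, fun i hi => ?_, fun i hi => ?_⟩
  · have := h i
    simpa [hi] using this
  · have := h i
    simpa [hi] using this

lemma col_lemma (k : ℕ) (hk : 0 < k) (g : Fin k → (Fin k → ℝ) → ℝ)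
    (hg : ∀ j, ContinuousOn (g j) (stdSimplex ℝ (Fin k)))
    (hg0 : ∀ j, ∀ x ∈ stdSimplex ℝ (Fin k), x j = 0 → g j x = 0)
    (hsum : ∀ x ∈ stdSimplex ℝ (Fin k), (k : ℝ) ≤ ∑ j, g j x) :
    ∃ x ∈ stdSimplex ℝ (Fin k), ∀ j, 1 ≤ g j x := by
  classical
  let ψ : Fin k → (Fin k → ℝ) → ℝ := fun j x => max 0 (1 - g j x)
  have hψc : ∀ j, ContinuousOn (ψ j) (stdSimplex ℝ (Fin k)) := fun j =>
    ContinuousOn.sup continuousOn_const (continuousOn_const.sub (hg j))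
  have hψ0 : ∀ j x, 0 ≤ ψ j x := fun j x => le_max_left _ _
  let S : (Fin k → ℝ) → ℝ := fun x => ∑ j, ψ j x
  have hSc : ContinuousOn S (stdSimplex ℝ (Fin k)) := continuousOn_finsetSum _ fun j _ => hψc j
  have hcl : IsClosed (stdSimplex ℝ (Fin k)) := (isCompact_stdSimplex ℝ (Fin k)).isClosed
  obtain ⟨x, hx, C, hC1, hC2⟩ := dual_kkm k hk
    (fun i => stdSimplex ℝ (Fin k) ∩ (fun x => ψ i x - x i * S x) ⁻¹' Set.Ici 0)
    (fun i => ContinuousOn.preimage_isClosed_of_isClosed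
      ((hψc i).sub ((continuous_apply i).continuousOn.mul hSc)) hcl isClosed_Ici)
    (by
      intro x hx
      by_contra hcon
      push Not at hcon
      have h1 : ∀ i, ψ i x < x i * S x := by
        intro i
        by_contra h
        refine hcon i ⟨hx, ?_⟩
        simp only [Set.mem_preimage, Set.mem_Ici]
        linarith
      have h2 : ∑ i, ψ i x < ∑ i, x i * S x :=
        Finset.sum_lt_sum_of_nonempty ⟨⟨0, hk⟩, Finset.mem_univ _⟩ fun i _ => h1 i
      rw [← Finset.sum_mul, hx.2, one_mul] at h2
      exact lt_irrefl _ h2)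
  have hge : ∀ i, x i * S x ≤ ψ i x := by
    intro i
    by_cases hi : i ∈ C
    · have := (hC1 i hi).2
      simp only [Set.mem_preimage, Set.mem_Ici] at this
      linarith
    · rw [hC2 i hi, zero_mul]; exact hψ0 i x
  have heq : ∀ i, x i * S x = ψ i x := by
    have h1 : ∑ i, x i * S x = ∑ i, ψ i x := by
      rw [← Finset.sum_mul, hx.2, one_mul]
    have := (Finset.sum_eq_sum_iff_of_le (s := Finset.univ) (fun i _ => hge i)).1 h1
    exact fun i => this i (Finset.mem_univ i)
  have hS0 : S x = 0 := by
    by_contra hne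
    have hpos : 0 < S x := lt_of_le_of_ne (Finset.sum_nonneg fun j _ => hψ0 j x) (Ne.symm hne)
    have h1 : ∀ j, g j x < 1 := by
      intro j
      by_cases hj : x j = 0
      · rw [hg0 j x hx hj]; exact one_pos
      · have h2 : 0 < x j := lt_of_le_of_ne (hx.1 j) (Ne.symm hj)
        have h3 : 0 < ψ j x := by rw [← heq j]; positivity
        rcases lt_max_iff.1 h3 with h | h
        · exact absurd h (lt_irrefl _)
        · linarith
    have h2 : ∑ j, g j x < ∑ _j : Fin k, (1 : ℝ) :=
      Finset.sum_lt_sum_of_nonempty ⟨⟨0, hk⟩, Finset.mem_univ _⟩ fun i _ => h1 i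
    have h3 := hsum x hx
    simp at h2
    linarith
  refine ⟨x, hx, fun j => ?_⟩
  have h1 := heq j
  rw [hS0, mul_zero] at h1
  have : 1 - g j x ≤ 0 := by rw [h1]; exact le_max_right _ _
  linarith

lemma core_lemma (n k : ℕ) (hk : 0 < k) (hn : k ≤ n) (f : Fin n → Fin k → (Fin k → ℝ) → ℝ)
    (hf : ∀ i j, Continuous (f i j))
    (hf0 : ∀ i j, ∀ x ∈ stdSimplex ℝ (Fin k), 0 ≤ f i j x)
    (hfz : ∀ i j x, x j = 0 → f i j x = 0)
    (hpos : ∀ x ∈ stdSimplex ℝ (Fin k), ∀ I : Finset (Fin n), I.card = n - k + 1 →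
      ∃ i ∈ I, ∃ j, 0 < f i j x) :
    ∃ x ∈ stdSimplex ℝ (Fin k), ∃ π : Fin k → Fin n, Function.Injective π ∧
      ∀ j, 0 < f (π j) j x := by
  classical
  let s : Fin n → (Fin k → ℝ) → ℝ := fun i x => ∑ j, f i j x
  have hs : ∀ i, Continuous (s i) := fun i => continuous_finsetSum _ fun j _ => hf i j
  have hs0 : ∀ i, ∀ x ∈ stdSimplex ℝ (Fin k), 0 ≤ s i x := fun i x hx =>
    Finset.sum_nonneg fun j _ => hf0 i j x hx
  let F : Finset (Finset (Fin n)) := Finset.powersetCard (n - k + 1) Finset.univ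
  have hF : F.Nonempty := Finset.powersetCard_nonempty.2 (by simp; omega)
  let p : (Fin k → ℝ) → ℝ := fun x =>
    F.inf' hF (fun I => (∑ i ∈ I, s i x) / ((n - k + 1 : ℕ) : ℝ))
  have hpc : Continuous p := by
    apply Continuous.finset_inf'_apply
    intro I _
    exact (continuous_finsetSum _ fun i _ => hs i).div_const _
  have hp0 : ∀ x ∈ stdSimplex ℝ (Fin k), 0 < p x := by
    intro x hx
    refine (Finset.lt_inf'_iff hF).2 fun I hI => ?_
    have hIc := (Finset.mem_powersetCard.1 hI).2
    obtain ⟨i, hi, j, hij⟩ := hpos x hx I hIc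
    have h1 : 0 < s i x := Finset.sum_pos' (fun j _ => hf0 i j x hx) ⟨j, Finset.mem_univ _, hij⟩
    have h2 : 0 < ∑ i ∈ I, s i x := Finset.sum_pos' (fun i _ => hs0 i x hx) ⟨i, hi, h1⟩
    positivity
  have hbad : ∀ x ∈ stdSimplex ℝ (Fin k),
      (Finset.univ.filter (fun i => s i x < p x)).card ≤ n - k := by
    intro x hx
    by_contra hcon
    obtain ⟨I, hI, hIc⟩ := Finset.exists_subset_card_eq
      (show n - k + 1 ≤ (Finset.univ.filter (fun i => s i x < p x)).card by omega)
    have h1 : p x ≤ (∑ i ∈ I, s i x) / ((n - k + 1 : ℕ) : ℝ) :=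
      Finset.inf'_le _ (Finset.mem_powersetCard.2 ⟨Finset.subset_univ _, hIc⟩)
    have h2 : ∑ i ∈ I, s i x < ∑ _i ∈ I, p x := by
      apply Finset.sum_lt_sum_of_nonempty
      · apply Finset.card_pos.1; omega
      · intro i hi
        exact (Finset.mem_filter.1 (hI hi)).2
    rw [Finset.sum_const, hIc, nsmul_eq_mul] at h2
    rw [le_div_iff₀ (by positivity)] at h1
    linarith
  let μ : Fin n → Fin k → (Fin k → ℝ) → ℝ := fun i j x => f i j x / max (s i x) (p x)
  have hden : ∀ i, ∀ x ∈ stdSimplex ℝ (Fin k), 0 < max (s i x) (p x) := fun i x hx =>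
    lt_max_of_lt_right (hp0 x hx)
  have hμ0 : ∀ i j, ∀ x ∈ stdSimplex ℝ (Fin k), 0 ≤ μ i j x := fun i j x hx =>
    div_nonneg (hf0 i j x hx) (hden i x hx).le
  have hrow : ∀ i x, ∑ j, μ i j x = s i x / max (s i x) (p x) := by
    intro i x
    simp only [μ]
    rw [← Finset.sum_div]
  have hrow1 : ∀ i, ∀ x ∈ stdSimplex ℝ (Fin k), ∑ j, μ i j x ≤ 1 := by
    intro i x hx
    rw [hrow, div_le_one (hden i x hx)]
    exact le_max_left _ _
  obtain ⟨x, hx, hcol⟩ := col_lemma k hk (fun j x => ∑ i, μ i j x)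
    (fun j => continuousOn_finsetSum _ fun i _ => (hf i j).continuousOn.div
      ((hs i).max hpc).continuousOn fun x hx => (hden i x hx).ne')
    (by
      intro j x hx hxj
      apply Finset.sum_eq_zero
      intro i _
      simp only [μ]
      rw [hfz i j x hxj, zero_div])
    (by
      intro x hx
      rw [Finset.sum_comm]
      have h1 : (Finset.univ.filter (fun i => ¬ s i x < p x)).card +
          (Finset.univ.filter (fun i => s i x < p x)).card = n := by
        rw [add_comm, Finset.card_filter_add_card_filter_not]; simp
      have h2 := hbad x hx
      have h3 : k ≤ (Finset.univ.filter (fun i => ¬ s i x < p x)).card := by omega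
      calc (k : ℝ) ≤ ((Finset.univ.filter (fun i => ¬ s i x < p x)).card : ℝ) := by
            exact_mod_cast h3
        _ = ∑ _i ∈ Finset.univ.filter (fun i => ¬ s i x < p x), (1 : ℝ) := by simp
        _ ≤ ∑ i ∈ Finset.univ.filter (fun i => ¬ s i x < p x), ∑ j, μ i j x := by
            apply Finset.sum_le_sum
            intro i hi
            have := not_lt.1 (Finset.mem_filter.1 hi).2
            have hd := hden i x hx
            rw [hrow, max_eq_left this]
            rw [max_eq_left this] at hd
            rw [div_self hd.ne']
        _ ≤ ∑ i, ∑ j, μ i j x :=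
            Finset.sum_le_sum_of_subset_of_nonneg (Finset.subset_univ _)
              fun i _ _ => Finset.sum_nonneg fun j _ => hμ0 i j x hx)
  refine ⟨x, hx, ?_⟩
  let t : Fin k → Finset (Fin n) := fun j => Finset.univ.filter (fun i => 0 < f i j x)
  obtain ⟨π, hπ, hπt⟩ := (Finset.all_card_le_biUnion_card_iff_exists_injective t).1 (by
    intro J
    have : (J.card : ℝ) ≤ ((J.biUnion t).card : ℝ) := by
      calc (J.card : ℝ) = ∑ _j ∈ J, (1 : ℝ) := by simp
        _ ≤ ∑ j ∈ J, ∑ i, μ i j x := Finset.sum_le_sum fun j _ => hcol j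
        _ = ∑ j ∈ J, ∑ i ∈ J.biUnion t, μ i j x := by
            apply Finset.sum_congr rfl
            intro j hj
            symm
            apply Finset.sum_subset (Finset.subset_univ _)
            intro i _ hi
            have h1 : ¬ 0 < f i j x := by
              intro h
              exact hi (Finset.mem_biUnion.2 ⟨j, hj, Finset.mem_filter.2 ⟨Finset.mem_univ _, h⟩⟩)
            have h2 : f i j x = 0 := le_antisymm (not_lt.1 h1) (hf0 i j x hx)
            simp only [μ]
            rw [h2, zero_div]
        _ = ∑ i ∈ J.biUnion t, ∑ j ∈ J, μ i j x := Finset.sum_comm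
        _ ≤ ∑ i ∈ J.biUnion t, ∑ j, μ i j x := by
            apply Finset.sum_le_sum
            intro i _
            exact Finset.sum_le_sum_of_subset_of_nonneg (Finset.subset_univ _)
              fun j _ _ => hμ0 i j x hx
        _ ≤ ∑ _i ∈ J.biUnion t, (1 : ℝ) := Finset.sum_le_sum fun i _ => hrow1 i x hx
        _ = ((J.biUnion t).card : ℝ) := by simp
    exact_mod_cast this)
  exact ⟨π, hπ, fun j => (Finset.mem_filter.1 (hπt j)).2⟩

/-- Soberón's sparse colorful KKM theorem. -/
theorem sparse_colorful_kkm (n k : ℕ) (hk : 0 < k) (hn : k ≤ n)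
    (A : Fin n → Fin k → Set (Fin k → ℝ))
    (hclosed : ∀ i j, IsClosed (A i j))
    (hsub : ∀ i j, A i j ⊆ stdSimplex ℝ (Fin k))
    (hKKM : ∀ I : Finset (Fin n), I.card = n - k + 1 →
      IsKKMCover (fun j => ⋃ i ∈ I, A i j)) :
    ∃ π : Fin k → Fin n, Function.Injective π ∧ (⋂ j, A (π j) j).Nonempty := by
  classical
  obtain ⟨⟨π, hπ⟩, x, -, h⟩ := limit_lemma (α := {π : Fin k → Fin n // Function.Injective π})
    (ι := Fin k) (stdSimplex ℝ (Fin k)) (isCompact_stdSimplex ℝ (Fin k))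
    (fun π j => A (π.1 j) j) (fun π j => hclosed _ _)
    (by
      intro ε hε
      let f : Fin n → Fin k → (Fin k → ℝ) → ℝ := fun i j x =>
        if (A i j).Nonempty then x j * max 0 (ε - Metric.infDist x (A i j)) else 0
      obtain ⟨x, hx, π, hπ, hf⟩ := core_lemma n k hk hn f
        (by
          intro i j
          by_cases hA : (A i j).Nonempty
          · simp only [f, hA, if_true]
            exact (continuous_apply j).mul
              (continuous_const.max (continuous_const.sub (Metric.continuous_infDist_pt _)))
          · simp only [f, hA, if_false]
            exact continuous_const)
        (by
          intro i j x hx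
          simp only [f]
          split_ifs
          · exact mul_nonneg (hx.1 j) (le_max_left _ _)
          · exact le_rfl)
        (by
          intro i j x hx
          simp only [f, hx, zero_mul, ite_self])
        (by
          intro x hx I hI
          obtain ⟨j, hj, hxj⟩ := hKKM I hI (Finset.univ.filter (fun j => x j ≠ 0))
            (by
              by_contra hne
              rw [Finset.not_nonempty_iff_eq_empty, Finset.filter_eq_empty_iff] at hne
              have h0 : ∑ j, x j = 0 := Finset.sum_eq_zero fun j hj => not_not.1 (hne hj)
              rw [hx.2] at h0
              exact one_ne_zero h0)
            x hx (by
              intro j hj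
              by_contra hne
              exact hj (Finset.mem_filter.2 ⟨Finset.mem_univ _, hne⟩))
          simp only [Set.mem_iUnion] at hxj
          obtain ⟨i, hi, hxA⟩ := hxj
          refine ⟨i, hi, j, ?_⟩
          have hA : (A i j).Nonempty := ⟨x, hxA⟩
          have hxp : 0 < x j := lt_of_le_of_ne (hx.1 j) (Ne.symm (Finset.mem_filter.1 hj).2)
          simp only [f, hA, if_true]
          rw [Metric.infDist_zero_of_mem hxA, sub_zero]
          exact mul_pos hxp (lt_max_of_lt_right hε))
      refine ⟨⟨π, hπ⟩, x, hx, fun j => ?_⟩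
      have hj := hf j
      by_cases hA : (A (π j) j).Nonempty
      · simp only [f, hA, if_true] at hj
        have h1 : 0 < max 0 (ε - Metric.infDist x (A (π j) j)) :=
          pos_of_mul_pos_right hj (hx.1 j)
        rcases lt_max_iff.1 h1 with h2 | h2
        · exact absurd h2 (lt_irrefl _)
        · obtain ⟨q, hq, hd⟩ := (Metric.infDist_lt_iff hA).1 (sub_pos.1 h2)
          exact ⟨q, hq, by rw [dist_comm]; exact hd.le⟩
      · simp only [f, hA, if_false] at hj
        exact absurd hj (lt_irrefl _))
  exact ⟨π, hπ, x, Set.mem_iInter.2 h⟩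
end

section
/- Let $P$ be a $(k-1)$-dimensional polytope and $p \in P$. Suppose for every nonempty proper face $\tau$ of $P$ we are given a closed set $A_\tau \subseteq P$ and a point $y_\tau \in \tau$, such that every face $\sigma$ of $P$ satisfies $\sigma \subseteq \bigcup_{\tau \subseteq \sigma} A_\tau$. Then there exist faces $\tau_1,\dots,\tau_k$ of $P$ with $p \in \mathrm{conv}\{y_{\tau_1},\dots,y_{\tau_k}\}$ and $\bigcap_{i=1}^k A_{\tau_i} \neq \emptyset$. -/
open Set

/-- `σ` is a nonempty proper face of the polytope `P`. -/
def IsProperFace {m : ℕ} (P σ : Set (EuclideanSpace ℝ (Fin m))) : Prop :=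
  σ.Nonempty ∧ σ ≠ P ∧ IsExtreme ℝ P σ

/-- `σ` is a nonempty face of the polytope `P` (possibly `P` itself). -/
def IsFace {m : ℕ} (P σ : Set (EuclideanSpace ℝ (Fin m))) : Prop :=
  IsProperFace P σ ∨ σ = P

section
open Topology Metric
set_option linter.unusedSectionVars false
variable {E : Type*} [NormedAddCommGroup E] [InnerProductSpace ℝ E] [FiniteDimensional ℝ E]

theorem inner_nonpos_zero {x : E} (h : inner ℝ x x ≤ 0) : x = 0 := by
  rw [real_inner_self_eq_norm_sq] at h
  exact norm_eq_zero.1 (by nlinarith [norm_nonneg x])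

theorem exists_proj (K : Set E) (hne : K.Nonempty) (hK : IsCompact K) (hc : Convex ℝ K) :
    ∃ π : E → E, (∀ u, π u ∈ K) ∧ (∀ u, ∀ w ∈ K, inner ℝ (u - π u) (w - π u) ≤ 0) ∧
      LipschitzWith 1 π := by
  have h := exists_norm_eq_iInf_of_complete_convex hne hK.isComplete hc
  choose π hπ h2 using h
  have h3 : ∀ u, ∀ w ∈ K, inner ℝ (u - π u) (w - π u) ≤ 0 := fun u =>
    (norm_eq_iInf_iff_real_inner_le_zero hc (hπ u)).1 (h2 u)
  refine ⟨π, hπ, h3, LipschitzWith.of_dist_le_mul fun u v => ?_⟩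
  have h4 := h3 u _ (hπ v)
  have h5 := h3 v _ (hπ u)
  have h6 : inner ℝ (π v - π u) (π v - π u) ≤ inner ℝ (v - u) (π v - π u) := by
    have e1 : inner ℝ (v - π v) (π u - π v) = - inner ℝ (v - π v) (π v - π u) := by
      rw [← inner_neg_right, neg_sub]
    have e2 : inner ℝ (u - π u) (π v - π u) - inner ℝ (v - π v) (π v - π u)
      = inner ℝ (π v - π u) (π v - π u) - inner ℝ (v - u) (π v - π u) := by
      rw [← inner_sub_left, ← inner_sub_left]; congr 1; abel
    linarith
  rw [real_inner_self_eq_norm_sq] at h6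
  have h7 := real_inner_le_norm (v - u) (π v - π u)
  rw [NNReal.coe_one, one_mul, dist_comm, dist_comm u v, dist_eq_norm, dist_eq_norm]
  by_contra hlt
  push Not at hlt
  nlinarith [norm_nonneg (v - u)]

theorem det_interp (L : E →L[ℝ] E) (s : Finset ℝ) (hs : Module.finrank ℝ E < s.card) :
    (1 + L).det = ∑ t ∈ s, (Lagrange.basis s id t).eval 1 * (1 + t • L).det := by
  classical
  let b := Module.finBasis ℝ E
  let M := LinearMap.toMatrix b b (L : E →ₗ[ℝ] E)
  let q : Polynomial ℝ := Matrix.det ((Polynomial.X : Polynomial ℝ) • M.map Polynomial.C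
    + (1 : Matrix _ _ ℝ).map Polynomial.C)
  have hq : ∀ t : ℝ, q.eval t = (1 + t • L).det := by
    intro t
    have : (1 + t • L).det = Matrix.det (1 + t • M) := by
      rw [ContinuousLinearMap.det, ← LinearMap.det_toMatrix b]
      congr 1
      simp [M]
    rw [this, ← Polynomial.coe_evalRingHom, RingHom.map_det]
    congr 1
    ext i j
    by_cases hij : i = j <;> simp [hij, add_comm, mul_comm t]
  have hd : q.degree < s.card := by
    refine lt_of_le_of_lt Polynomial.degree_le_natDegree ?_
    have := Polynomial.natDegree_det_X_add_C_le M 1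
    rw [Fintype.card_fin] at this
    exact_mod_cast lt_of_le_of_lt this hs
  have h1 := Lagrange.eq_interpolate (v := id) (s := s) (Set.injOn_id _) hd
  have h2 := congrArg (Polynomial.eval 1) h1
  rw [hq, one_smul] at h2
  rw [h2, Lagrange.interpolate_apply, Polynomial.eval_finsetSum]
  refine Finset.sum_congr rfl fun t _ => ?_
  simp [hq, mul_comm]

theorem bij_aux (g : E → E) (K : NNReal) (hK : K < 1) (hg : LipschitzWith K g) :
    Function.Bijective (fun x => x + g x) := by
  constructor
  · intro x y hxy
    have h1 : x - y = g y - g x := by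
      have : x + g x = y + g y := hxy
      rw [sub_eq_sub_iff_add_eq_add, this, add_comm]
    have h2 := hg.dist_le_mul y x
    rw [dist_eq_norm, ← h1, dist_comm, dist_eq_norm] at h2
    have : (K : ℝ) < 1 := by exact_mod_cast hK
    have h3 : ‖x - y‖ = 0 := by nlinarith [norm_nonneg (x - y)]
    exact sub_eq_zero.1 (norm_eq_zero.1 h3)
  · intro y
    have hc : ContractingWith K (fun x => y - g x) := by
      refine ⟨hK, LipschitzWith.of_dist_le_mul fun a b => ?_⟩
      rw [dist_sub_left]; exact hg.dist_le_mul a b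
    refine ⟨ContractingWith.fixedPoint _ hc, ?_⟩
    have := hc.fixedPoint_isFixedPt
    have h : y - g (ContractingWith.fixedPoint _ hc) = ContractingWith.fixedPoint _ hc := this
    simp only
    nth_rewrite 1 [← h]
    abel

theorem proj_ball_norm {R : ℝ} (hR : 0 < R) {π : E → E} (hπ : ∀ u, π u ∈ closedBall (0 : E) R)
    (h3 : ∀ u, ∀ w ∈ closedBall (0 : E) R, inner ℝ (u - π u) (w - π u) ≤ 0) (u : E)
    (hu : R ≤ ‖u‖) : ‖π u‖ = R := by
  have hu0 : 0 < ‖u‖ := lt_of_lt_of_le hR hu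
  set w : E := (R / ‖u‖) • u with hw
  have hwn : ‖w‖ = R := by
    rw [hw, norm_smul, Real.norm_of_nonneg (by positivity)]; field_simp
  have h := h3 u w (by simp [hwn])
  have h2 : 0 ≤ inner ℝ (u - w) (w - π u) := by
    have e : u - w = (1 - R / ‖u‖) • u := by rw [hw, sub_smul, one_smul]
    rw [e, inner_smul_left]
    apply mul_nonneg
    · simp only [conj_trivial]
      rw [sub_nonneg, div_le_one hu0]; exact hu
    · rw [inner_sub_right, hw, inner_smul_right, real_inner_self_eq_norm_sq]
      have h5 := real_inner_le_norm u (π u)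
      have h6 : ‖π u‖ ≤ R := by simpa using hπ u
      have h7 : R / ‖u‖ * ‖u‖ ^ 2 = R * ‖u‖ := by field_simp
      nlinarith
  have h3 : inner ℝ (w - π u) (w - π u) ≤ 0 := by
    have e : inner ℝ (w - π u) (w - π u) = inner ℝ (u - π u) (w - π u)
      - inner ℝ (u - w) (w - π u) := by
      rw [← inner_sub_left]; congr 1; abel
    linarith
  have h4 : w - π u = 0 := inner_nonpos_zero h3
  rw [← sub_eq_zero.1 h4, hwn]

theorem no_retract [MeasurableSpace E] [BorelSpace E] {R : ℝ} (hR : 0 < R) (G : E → E)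
    (hG : ContDiff ℝ 1 G) (hn : ∀ x, ‖G x‖ = R) (hid : ∀ x, ‖x‖ = R → G x = x) : False := by
  classical
  let μ : MeasureTheory.Measure E := MeasureTheory.Measure.addHaar
  let U := ball (0 : E) R
  let B := closedBall (0 : E) R
  have hBc : IsCompact B := isCompact_closedBall _ _
  let g : E → E := fun x => G x - x
  have hg : ContDiff ℝ 1 g := hG.sub contDiff_id
  let L : E → E →L[ℝ] E := fun x => fderiv ℝ g x
  have hLc : Continuous L := hg.continuous_fderiv one_ne_zero
  have hgd : ∀ x, HasFDerivAt g (L x) x := fun x =>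
    (hg.differentiable one_ne_zero x).hasFDerivAt
  obtain ⟨K, hK⟩ := hg.contDiffOn.exists_lipschitzOnWith (s := B) one_ne_zero
    (convex_closedBall _ _) hBc
  obtain ⟨π, hπ1, hπ2, hπ3⟩ := exists_proj B ⟨0, by simp [B, hR.le]⟩ hBc (convex_closedBall _ _)
  have hπid : ∀ x ∈ B, π x = x := by
    intro x hx
    have := inner_nonpos_zero (hπ2 x x hx)
    exact (sub_eq_zero.1 this).symm
  let g' : E → E := fun x => g (π x)
  have hg'L : LipschitzWith K g' := by
    have := hK.comp (hπ3.lipschitzOnWith (s := univ)) (fun x _ => hπ1 x)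
    rw [mul_one] at this
    exact lipschitzOnWith_univ.1 this
  have hg'out : ∀ x, x ∉ U → g' x = 0 := by
    intro x hx
    have hx' : R ≤ ‖x‖ := by simpa [U] using hx
    have := hid (π x) (proj_ball_norm hR hπ1 hπ2 x hx')
    simp [g', g, this]
  have hdetc : Continuous (fun z : ℝ × E => (1 + z.1 • L z.2).det) := by
    refine ContinuousLinearMap.continuous_det.comp ?_
    fun_prop
  have hpos : ∀ᶠ t in 𝓝 (0 : ℝ), ∀ x ∈ B, 0 < (1 + t • L x).det := by
    refine hBc.eventually_forall_of_forall_eventually fun x _ => ?_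
    refine (hdetc.tendsto (0, x)).eventually (lt_mem_nhds ?_)
    simp [ContinuousLinearMap.det]
  have hsm : ∀ᶠ t in 𝓝 (0 : ℝ), ‖t‖₊ * K < 1 := by
    have : Continuous (fun t : ℝ => ‖t‖₊ * K) := by fun_prop
    exact (this.tendsto 0).eventually (gt_mem_nhds (by simp))
  have hvol : ∀ᶠ t in 𝓝 (0 : ℝ), ∫ x in U, (1 + t • L x).det ∂μ = μ.real U := by
    filter_upwards [hpos, hsm] with t ht1 ht2
    let Ft : E → E := fun x => x + t • g' x
    have hLip : LipschitzWith (‖t‖₊ * K) (fun x => t • g' x) := by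
      refine LipschitzWith.of_dist_le_mul fun a b => ?_
      rw [dist_smul₀]
      have := hg'L.dist_le_mul a b
      push_cast
      rw [mul_assoc]
      gcongr
    have hbij : Function.Bijective Ft := bij_aux _ _ ht2 hLip
    have hout : ∀ x, x ∉ U → Ft x = x := fun x hx => by simp [Ft, hg'out x hx]
    have himg : Ft '' U = U := by
      ext z
      constructor
      · rintro ⟨x, hx, rfl⟩
        by_contra hc
        have := hbij.1 (hout _ hc)
        rw [this] at hc
        exact hc hx
      · intro hz
        obtain ⟨x, rfl⟩ := hbij.2 z
        refine ⟨x, ?_, rfl⟩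
        by_contra hc
        rw [hout x hc] at hz
        exact hc hz
    have hder : ∀ x ∈ U, HasFDerivWithinAt Ft (1 + t • L x) U x := by
      intro x hx
      have h1 : HasFDerivAt (fun x => x + t • g x) (1 + t • L x) x :=
        (hasFDerivAt_id x).add ((hgd x).const_smul t)
      refine h1.hasFDerivWithinAt.congr (fun z hz => ?_) ?_
      · simp only [Ft, g', hπid z (ball_subset_closedBall hz)]
      · simp only [Ft, g', hπid x (ball_subset_closedBall hx)]
    have := MeasureTheory.integral_image_eq_integral_abs_det_fderiv_smul μ
      (measurableSet_ball : MeasurableSet U) hder hbij.1.injOn (fun _ => (1 : ℝ))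
    rw [himg] at this
    simp only [smul_eq_mul, mul_one, MeasureTheory.integral_const, 
      MeasureTheory.measureReal_restrict_apply_univ] at this
    rw [this]
    refine MeasureTheory.setIntegral_congr_fun measurableSet_ball fun x hx => ?_
    exact (abs_of_pos (ht1 x (ball_subset_closedBall hx))).symm
  have hinf : {t : ℝ | ∫ x in U, (1 + t • L x).det ∂μ = μ.real U}.Infinite :=
    infinite_of_mem_nhds 0 hvol
  obtain ⟨s, hs1, hs2⟩ := hinf.exists_subset_card_eq (Module.finrank ℝ E + 1)
  have hint : ∀ t : ℝ, MeasureTheory.IntegrableOn (fun x => (1 + t • L x).det) U μ := by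
    intro t
    have hc : Continuous (fun x => (1 + t • L x).det) :=
      hdetc.comp (Continuous.prodMk continuous_const continuous_id)
    exact (hc.continuousOn.integrableOn_compact hBc).mono_set ball_subset_closedBall
  have hone : ∫ x in U, (1 + L x).det ∂μ = μ.real U := by
    simp_rw [fun x => det_interp (L x) s (by omega)]
    rw [MeasureTheory.integral_finsetSum _ (fun t _ => (hint t).const_mul _)]
    simp_rw [MeasureTheory.integral_const_mul]
    rw [Finset.sum_congr rfl (fun t ht => by rw [show _ = _ from hs1 ht]), ← Finset.sum_mul,
      ← Polynomial.eval_finsetSum]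
    have := Lagrange.sum_basis (v := id) (s := s) (Set.injOn_id _)
      (Finset.card_pos.1 (by omega))
    rw [this]; simp
  have hzero : ∀ x, (1 + L x).det = 0 := by
    intro x
    by_contra hne
    have h1 : HasFDerivAt G (1 + L x) x := by
      have := (hasFDerivAt_id x).add (hgd x)
      refine this.congr_of_eventuallyEq (Filter.Eventually.of_forall fun z => ?_)
      simp [g]
    have hsurj : Function.Surjective (1 + L x : E →L[ℝ] E) := by
      have := (LinearMap.equivOfDetNeZero ((1 + L x : E →L[ℝ] E) : E →ₗ[ℝ] E) hne).surjective
      exact this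
    obtain ⟨v, hv⟩ := hsurj (G x)
    have h2 : HasFDerivAt (fun z => ‖G z‖ ^ 2) (2 • (innerSL ℝ (G x)).comp (1 + L x)) x :=
      h1.norm_sq
    have h3 : HasFDerivAt (fun z => ‖G z‖ ^ 2) (0 : E →L[ℝ] ℝ) x := by
      simp_rw [hn]; exact hasFDerivAt_const _ _
    have h4 := congrArg (fun T : E →L[ℝ] ℝ => T v) (h2.unique h3)
    have h5 : (2 : ℝ) * inner ℝ (G x) ((1 + L x : E →L[ℝ] E) v) = 0 := by
      simpa [mul_add, inner_add_right] using h4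
    rw [hv, real_inner_self_eq_norm_sq, hn] at h5
    nlinarith
  simp_rw [hzero] at hone
  have : 0 < μ.real U := by
    rw [MeasureTheory.measureReal_def, ENNReal.toReal_pos_iff]
    exact ⟨measure_ball_pos μ _ hR, MeasureTheory.measure_ball_lt_top⟩
  simp at hone
  linarith
theorem bounded_fixed [MeasurableSpace E] [BorelSpace E] (h : E → E) (hc : Continuous h)
    {M : ℝ} (hM0 : 0 < M) (hM : ∀ x, ‖h x‖ ≤ M) : ∃ x, h x = x := by
  by_contra hno
  push Not at hno
  let l : E → ℝ := fun x => max 0 (min 1 (2 - ‖x‖ / M))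
  have hl0 : ∀ x, 0 ≤ l x := fun x => le_max_left _ _
  have hl1 : ∀ x, l x ≤ 1 := fun x => max_le zero_le_one (min_le_left _ _)
  have hlin : ∀ x, ‖x‖ ≤ M → l x = 1 := by
    intro x hx
    have : ‖x‖ / M ≤ 1 := (div_le_one hM0).2 hx
    simp only [l]
    rw [min_eq_left (by linarith), max_eq_right zero_le_one]
  have hlout : ∀ x, 2 * M ≤ ‖x‖ → l x = 0 := by
    intro x hx
    have : 2 ≤ ‖x‖ / M := (le_div_iff₀ hM0).2 hx
    simp only [l]
    exact max_eq_left ((min_le_right _ _).trans (by linarith))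
  let h1 : E → E := fun x => l x • h x
  have h1c : Continuous h1 := by
    have : Continuous l := by fun_prop
    exact this.smul hc
  have h1n : ∀ x, ‖h1 x‖ ≤ M := by
    intro x
    rw [norm_smul, Real.norm_of_nonneg (hl0 x)]
    have := hM x
    nlinarith [hl0 x, hl1 x, norm_nonneg (h x)]
  have h1out : ∀ x, 2 * M ≤ ‖x‖ → h1 x = 0 := fun x hx => by simp [h1, hlout x hx]
  have h1ne : ∀ x, 0 < ‖x - h1 x‖ := by
    intro x
    rw [norm_pos_iff, sub_ne_zero]
    rcases le_or_gt ‖x‖ M with hx | hx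
    · simp only [h1, hlin x hx, one_smul]; exact (hno x).symm
    · intro he
      have := h1n x
      rw [← he] at this
      linarith
  obtain ⟨x0, hx0, hmin⟩ := (isCompact_closedBall (0 : E) (3 * M)).exists_isMinOn
    ⟨0, by simp; positivity⟩ (f := fun x => ‖x - h1 x‖) (by fun_prop)
  let δ := ‖x0 - h1 x0‖
  have hδ : 0 < δ := h1ne x0
  have hδle : ∀ x, ‖x‖ ≤ 3 * M → δ ≤ ‖x - h1 x‖ := fun x hx => hmin (by simpa using hx)
  let t : E → Set E := fun x => {v | ‖v - h1 x‖ < δ ∧ (3 * M ≤ ‖x‖ → v = 0)}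
  have htc : ∀ x, Convex ℝ (t x) := by
    intro x
    have e : t x = ball (h1 x) δ ∩ {v | 3 * M ≤ ‖x‖ → v = 0} := by
      ext v; simp [t, dist_eq_norm]
    rw [e]
    refine (convex_ball _ _).inter ?_
    intro a ha b hb u v _ _ _ hx
    simp [ha hx, hb hx]
  obtain ⟨h2, hh2⟩ := exists_contMDiffMap_forall_mem_convex_of_local_const (n := 1)
    (modelWithCornersSelf ℝ E) (t := t) htc (by
      intro x
      rcases lt_or_ge (2 * M) ‖x‖ with hx | hx
      · refine ⟨0, ?_⟩
        filter_upwards [(continuous_norm.tendsto x).eventually (lt_mem_nhds hx)] with y hy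
        refine ⟨?_, fun _ => rfl⟩
        rw [h1out y hy.le]; simpa using hδ
      · refine ⟨h1 x, ?_⟩
        have hx' : ‖x‖ < 3 * M := by linarith
        filter_upwards [(continuous_norm.tendsto x).eventually (gt_mem_nhds hx'),
          (h1c.tendsto x).eventually (ball_mem_nhds _ hδ)] with y hy hy2
        refine ⟨?_, fun h => absurd h (not_le.2 hy)⟩
        rw [← dist_eq_norm, dist_comm]; exact hy2)
  have h2d : ContDiff ℝ 1 h2 := h2.contMDiff.contDiff
  have hFne : ∀ x, x - h2 x ≠ 0 := by
    intro x hx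
    rw [sub_eq_zero] at hx
    obtain ⟨ha, hb⟩ := hh2 x
    rcases le_or_gt ‖x‖ (3 * M) with h | h
    · rw [← hx] at ha
      exact absurd (hδle x h) (not_le.2 ha)
    · rw [hb h.le] at hx
      rw [hx, norm_zero] at h
      linarith
  have hR : 0 < 3 * M := by linarith
  have hFd : ContDiff ℝ 1 (fun x => x - h2 x) := contDiff_id.sub h2d
  refine no_retract hR (fun x => (3 * M / ‖x - h2 x‖) • (x - h2 x)) ?_ ?_ ?_
  · exact (contDiff_const.div (hFd.norm ℝ hFne) (fun x => norm_ne_zero_iff.2 (hFne x))).smul hFd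
  · intro x
    have := norm_pos_iff.2 (hFne x)
    rw [norm_smul, Real.norm_of_nonneg (by positivity)]
    field_simp
  · intro x hx
    have := (hh2 x).2 hx.ge
    simp only [this, sub_zero, hx]
    rw [div_self hR.ne', one_smul]

theorem exists_vi [MeasurableSpace E] [BorelSpace E] (K : Set E) (hne : K.Nonempty)
    (hK : IsCompact K) (hcv : Convex ℝ K) (c : E → E) (hc : Continuous c) :
    ∃ q ∈ K, ∀ z ∈ K, inner ℝ (c q) (z - q) ≤ 0 := by
  obtain ⟨π, h1, h2, h3⟩ := exists_proj K hne hK hcv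
  obtain ⟨M, hM⟩ := hK.exists_bound_of_continuousOn (f := fun x => x + c x) (by fun_prop)
  have hπc := h3.continuous
  obtain ⟨x, hx⟩ := bounded_fixed (fun x => π x + c (π x)) (by fun_prop)
    (M := |M| + 1) (by positivity)
    (fun x => (hM _ (h1 x)).trans (by linarith [le_abs_self M]))
  refine ⟨π x, h1 x, fun z hz => ?_⟩
  have := h2 x z hz
  have e : x - π x = c (π x) := by
    nth_rewrite 1 [← hx]; abel
  rwa [e] at this

theorem extreme_finite (V : Finset E) : {B : Set E | IsExtreme ℝ (convexHull ℝ (V : Set E)) B}.Finite := by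
  classical
  let Φ : Set E → Set (Finset E) := fun B => {W | W ⊆ V ∧ convexHull ℝ (W : Set E) ⊆ B}
  have hfin : {𝒲 : Set (Finset E) | 𝒲 ⊆ (V.powerset : Set (Finset E))}.Finite :=
    (Finset.finite_toSet _).finite_subsets
  refine Set.Finite.of_injOn (f := Φ) (t := {𝒲 | 𝒲 ⊆ (V.powerset : Set (Finset E))}) ?_ ?_ hfin
  · intro B _ W hW
    simpa using hW.1
  · have key : ∀ B, IsExtreme ℝ (convexHull ℝ (V : Set E)) B →
        B = ⋃ W ∈ Φ B, convexHull ℝ (W : Set E) := by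
      intro B hB
      apply Subset.antisymm
      · intro x hx
        obtain ⟨w, hw0, hw1, hwx⟩ := Finset.mem_convexHull'.1 (hB.subset hx)
        let W := V.filter (fun v => 0 < w v)
        have hWV : W ⊆ V := Finset.filter_subset _ _
        have hz : ∀ v ∈ V, v ∉ W → w v = 0 := by
          intro v hv hvW
          have := hw0 v hv
          by_contra hne
          exact hvW (Finset.mem_filter.2 ⟨hv, lt_of_le_of_ne this (Ne.symm hne)⟩)
        have hs1 : ∑ v ∈ W, w v = 1 := by
          rw [← hw1]; exact Finset.sum_subset hWV hz
        have hsx : ∑ v ∈ W, w v • v = x := by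
          rw [← hwx]; exact Finset.sum_subset hWV (fun v a b => by rw [hz v a b, zero_smul])
        have hxW : x ∈ convexHull ℝ (W : Set E) :=
          Finset.mem_convexHull'.2 ⟨w, fun v hv => hw0 v (hWV hv), hs1, hsx⟩
        simp only [mem_iUnion]
        refine ⟨W, ⟨hWV, ?_⟩, hxW⟩
        intro z hzW
        obtain ⟨u, hu0, hu1, huz⟩ := Finset.mem_convexHull'.1 hzW
        obtain ⟨ε, hε0, hε1, hεw⟩ : ∃ ε : ℝ, 0 < ε ∧ ε < 1 ∧ ∀ v ∈ W, ε ≤ w v := by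
          have hne : W.Nonempty := by
            by_contra hc
            rw [Finset.not_nonempty_iff_eq_empty] at hc
            rw [hc] at hs1; simp at hs1
          obtain ⟨v0, hv0, hmin⟩ := W.exists_min_image w hne
          have hp : 0 < w v0 := (Finset.mem_filter.1 hv0).2
          refine ⟨min (w v0) (1 / 2), lt_min hp (by norm_num),
            lt_of_le_of_lt (min_le_right _ _) (by norm_num), fun v hv => ?_⟩
          exact (min_le_left _ _).trans (hmin v hv)
        have hu_le : ∀ v ∈ W, u v ≤ 1 := fun v hv => by
          rw [← hu1]; exact Finset.single_le_sum hu0 hv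
        have h1e : 0 < 1 - ε := by linarith
        let z' := ∑ v ∈ W, ((w v - ε * u v) / (1 - ε)) • v
        have hz' : z' ∈ convexHull ℝ (W : Set E) := by
          refine Finset.mem_convexHull'.2 ⟨_, fun v hv => ?_, ?_, rfl⟩
          · apply div_nonneg _ h1e.le
            nlinarith [hu_le v hv, hεw v hv]
          · rw [← Finset.sum_div, Finset.sum_sub_distrib, ← Finset.mul_sum, hs1, hu1]
            field_simp
        have hmono : convexHull ℝ (W : Set E) ⊆ convexHull ℝ (V : Set E) :=
          convexHull_mono (by exact_mod_cast hWV)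
        refine hB.left_mem_of_mem_openSegment (hmono hzW) (hmono hz') hx
          ⟨ε, 1 - ε, hε0, h1e, by ring, ?_⟩
        simp only [z']
        rw [← huz, ← hsx, Finset.smul_sum, Finset.smul_sum, ← Finset.sum_add_distrib]
        refine Finset.sum_congr rfl fun v _ => ?_
        rw [smul_smul, smul_smul, ← add_smul]
        congr 1
        field_simp
        ring
      · simp only [iUnion_subset_iff]
        exact fun W hW => hW.2
    intro B hB B' hB' he
    rw [key B hB, key B' hB', he]

end

/-- Komiya's theorem. -/
theorem komiya (k : ℕ) (hk : 1 ≤ k)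
    (V : Finset (EuclideanSpace ℝ (Fin (k - 1))))
    (P : Set (EuclideanSpace ℝ (Fin (k - 1)))) (hP : P = convexHull ℝ ↑V)
    (hdim : affineSpan ℝ (V : Set (EuclideanSpace ℝ (Fin (k - 1)))) = ⊤)
    (p : EuclideanSpace ℝ (Fin (k - 1))) (hp : p ∈ P)
    (A : Set (EuclideanSpace ℝ (Fin (k - 1))) → Set (EuclideanSpace ℝ (Fin (k - 1))))
    (y : Set (EuclideanSpace ℝ (Fin (k - 1))) → EuclideanSpace ℝ (Fin (k - 1)))
    (hA : ∀ τ, IsProperFace P τ → IsClosed (A τ) ∧ A τ ⊆ P)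
    (hy : ∀ τ, IsProperFace P τ → y τ ∈ τ)
    (hcover : ∀ σ, IsFace P σ →
      σ ⊆ ⋃ τ ∈ {τ | IsProperFace P τ ∧ τ ⊆ σ}, A τ) :
    ∃ τ : Fin k → Set (EuclideanSpace ℝ (Fin (k - 1))),
      (∀ i, IsProperFace P (τ i)) ∧
      p ∈ convexHull ℝ (Set.range fun i => y (τ i)) ∧
      (⋂ i, A (τ i)).Nonempty := by
  classical
  have hPc : IsCompact P := hP ▸ V.finite_toSet.isCompact_convexHull (𝕜 := ℝ)
  have hPcv : Convex ℝ P := hP ▸ convex_convexHull ℝ _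
  have hfin : {τ | IsProperFace P τ}.Finite := by
    refine (extreme_finite V).subset fun τ hτ => ?_
    have := hτ.2.2
    rwa [hP] at this
  have claim : ∃ x, p ∈ convexHull ℝ (y '' {τ | IsProperFace P τ ∧ x ∈ A τ}) := by
    by_contra hno
    push Not at hno
    obtain ⟨c, hc⟩ := exists_continuous_forall_mem_convex_of_local_const
      (X := EuclideanSpace ℝ (Fin (k - 1)))
      (t := fun x => {c : EuclideanSpace ℝ (Fin (k - 1)) |
        ∀ τ, IsProperFace P τ → x ∈ A τ → 0 < inner ℝ c (p - y τ)})
      (by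
        intro x a ha b hb u v hu hv huv τ hτ hx
        have h1 := ha τ hτ hx
        have h2 := hb τ hτ hx
        rw [inner_add_left, inner_smul_left, inner_smul_left]
        simp only [conj_trivial]
        rcases eq_or_lt_of_le hu with h | h
        · have : v = 1 := by linarith
          subst h; subst this; simpa using h2
        · have := mul_pos h h1
          have := mul_nonneg hv h2.le
          linarith)
      (by
        intro x
        have hcl : IsClosed (convexHull ℝ (y '' {τ | IsProperFace P τ ∧ x ∈ A τ})) :=
          ((hfin.subset fun τ hτ => hτ.1).image y).isClosed_convexHull (𝕜 := ℝ)
        obtain ⟨f, u, hf1, hf2⟩ := geometric_hahn_banach_point_closed (convex_convexHull ℝ _)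
          hcl (hno x)
        refine ⟨-(InnerProductSpace.toDual ℝ _).symm f, ?_⟩
        have hev : ∀ᶠ z in nhds x, ∀ τ ∈ {τ | IsProperFace P τ}, z ∈ A τ → x ∈ A τ := by
          rw [Filter.eventually_all_finite hfin]
          intro τ hτ
          by_cases hx : x ∈ A τ
          · exact Filter.Eventually.of_forall fun _ _ => hx
          · filter_upwards [(hA τ hτ).1.isOpen_compl.mem_nhds hx] with z hz hz2
            exact absurd hz2 hz
        filter_upwards [hev] with z hz τ hτ hzτ
        have h3 := hf2 (y τ) (subset_convexHull ℝ _ ⟨τ, ⟨hτ, hz τ hτ hzτ⟩, rfl⟩)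
        rw [inner_neg_left, InnerProductSpace.toDual_symm_apply, map_sub]
        linarith)
    obtain ⟨q, hq, hvi⟩ := exists_vi P ⟨p, hp⟩ hPc hPcv c c.continuous
    let σ : Set (EuclideanSpace ℝ (Fin (k - 1))) := {z ∈ P | inner ℝ (c q) (z - q) = 0}
    have hσ : IsFace P σ := by
      by_cases he : σ = P
      · exact Or.inr he
      · refine Or.inl ⟨⟨q, hq, by simp⟩, he, ⟨fun z hz => hz.1, ?_⟩⟩
        rintro a ha b hb z ⟨hz, hz0⟩ ⟨s, t, hs, ht, hst, rfl⟩
        refine ⟨ha, le_antisymm (hvi a ha) ?_⟩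
        have e : s • a + t • b - q = s • (a - q) + t • (b - q) := by
          have : q = s • q + t • q := by rw [← add_smul, hst, one_smul]
          nth_rewrite 1 [this]
          rw [smul_sub, smul_sub]; abel
        rw [e, inner_add_right, inner_smul_right, inner_smul_right] at hz0
        have hb' := mul_nonneg ht.le (neg_nonneg.2 (hvi b hb))
        by_contra hneg
        push Not at hneg
        have := mul_pos hs (neg_pos.2 hneg)
        linarith
    have hqσ : q ∈ σ := ⟨hq, by simp⟩
    have hcov := hcover σ hσ hqσ
    simp only [mem_iUnion, mem_ofPred_eq] at hcov
    obtain ⟨τ, ⟨hτ, hτσ⟩, hqτ⟩ := hcov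
    have h1 := hc q τ hτ hqτ
    have h2 := (hτσ (hy τ hτ)).2
    have h3 := hvi p hp
    rw [inner_sub_right] at h1 h2 h3
    linarith
  obtain ⟨x, hx⟩ := claim
  rw [convexHull_eq_union] at hx
  simp only [mem_iUnion] at hx
  obtain ⟨t, ht, hind, hpt⟩ := hx
  have hcard : Fintype.card t ≤ Fintype.card (Fin k) := by
    have := hind.card_le_finrank_succ
    have h2 := Submodule.finrank_le (vectorSpan ℝ (range ((↑) : t → EuclideanSpace ℝ (Fin (k - 1)))))
    rw [finrank_euclideanSpace_fin] at h2
    rw [Fintype.card_fin]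
    omega
  obtain ⟨e⟩ := Function.Embedding.nonempty_of_card_le hcard
  have : Nonempty t := by
    have : (convexHull ℝ (t : Set (EuclideanSpace ℝ (Fin (k - 1))))).Nonempty := ⟨p, hpt⟩
    exact (convexHull_nonempty_iff.1 this).to_subtype
  have hsurj := Function.invFun_surjective e.injective
  have hch : ∀ v : t, ∃ τ, (IsProperFace P τ ∧ x ∈ A τ) ∧ y τ = v := fun v => ht v.2
  choose φ hφ hφy using hch
  refine ⟨fun i => φ (Function.invFun e i), fun i => (hφ _).1, ?_, x, ?_⟩
  · refine convexHull_mono ?_ hpt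
    intro v hv
    obtain ⟨i, hi⟩ := hsurj ⟨v, hv⟩
    refine ⟨i, ?_⟩
    simp only [hi, hφy]
  · exact mem_iInter.2 fun i => (hφ _).2
end

section
/- Let $P$ be a $(k-1)$-dimensional polytope, $p \in P$, and for every nonempty proper face $\tau$ of $P$ let $A^1_\tau,\dots,A^k_\tau \subseteq P$ be closed sets and $y^1_\tau,\dots,y^k_\tau \in \tau$ points. If for every $i \in [k]$ and every face $\sigma$ of $P$ we have $\sigma \subseteq \bigcup_{\tau\subseteq\sigma} A^i_\tau$, then there exist faces $\tau_1,\dots,\tau_k$ such that $p \in \mathrm{conv}\{y^1_{\tau_1},\dots,y^k_{\tau_k}\}$ and $\bigcap_{i=1}^k A^i_{\tau_i} \neq \emptyset$. -/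
open Set

def SDom {X I α : Type*} [LinearOrder α] (r : I → X → α) (B : Finset X) : Prop :=
  ∀ y, ∃ i, ∀ x ∈ B, r i y ≤ r i x

theorem SDom.mono {X I α : Type*} [LinearOrder α] {r : I → X → α} {B B' : Finset X}
    (h : SDom r B) (hs : B' ⊆ B) : SDom r B' := fun y => by
  obtain ⟨i, hi⟩ := h y
  exact ⟨i, fun x hx => hi x (hs hx)⟩

theorem scarf_pivot {X I α : Type*} [LinearOrder α] [Fintype X] [Fintype I] [DecidableEq X]
    (r : I → X → α) (hinj : ∀ i, Function.Injective (r i)) (B : Finset X) (hB : SDom r B)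
    (hne : B.Nonempty) (hcard : B.card + 1 = Fintype.card I)
    (hM : ∀ k, ∃ y, ∀ l, l ≠ k → ∃ b ∈ B, r l b < r l y) (S : Finset X)
    (hS : ∀ x, x ∈ S ↔ x ∉ B ∧ SDom r (insert x B)) : S.card = 2 := by
  classical
  have hmin : ∀ i, ∃ b ∈ B, ∀ x ∈ B, r i b ≤ r i x := fun i => B.exists_min_image (r i) hne
  choose m hmB hm using hmin
  have hsurj : ∀ x ∈ B, ∃ i, m i = x := by
    intro x hx
    obtain ⟨i, hi⟩ := hB x
    exact ⟨i, hinj i (le_antisymm (hm i x hx) (hi _ (hmB i)))⟩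
  obtain ⟨i, -, j, -, hij, hmij⟩ : ∃ i ∈ (Finset.univ : Finset I), ∃ j ∈ (Finset.univ : Finset I),
      i ≠ j ∧ m i = m j :=
    Finset.exists_ne_map_eq_of_card_lt_of_maps_to (t := B)
      (by rw [Finset.card_univ]; omega) (fun i _ => hmB i)
  -- injectivity off k
  have hinjoff : ∀ k k', k ≠ k' → m k = m k' → ∀ a b, a ≠ k → b ≠ k → m a = m b → a = b := by
    intro k k' hkk' hmk a b ha hb hab
    have him : (Finset.univ.erase k).image m = B := by
      ext x
      simp only [Finset.mem_image, Finset.mem_erase, Finset.mem_univ, and_true]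
      constructor
      · rintro ⟨l, _, rfl⟩; exact hmB l
      · intro hx
        obtain ⟨l, rfl⟩ := hsurj x hx
        by_cases hl : l = k
        · exact ⟨k', hkk'.symm, by rw [hl, hmk]⟩
        · exact ⟨l, hl, rfl⟩
    have hc : ((Finset.univ.erase k).image m).card = (Finset.univ.erase k).card := by
      rw [him, Finset.card_erase_of_mem (Finset.mem_univ _), Finset.card_univ]; omega
    exact Finset.card_image_iff.1 hc (by simpa using ha) (by simpa using hb) hab
  -- the new points
  have hx : ∀ k, ∃ x, (∀ l, l ≠ k → r l (m l) < r l x) ∧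
      ∀ y, (∀ l, l ≠ k → r l (m l) < r l y) → r k y ≤ r k x := by
    intro k
    obtain ⟨y0, hy0⟩ := hM k
    obtain ⟨x, hx, hx'⟩ := (Finset.univ.filter fun y => ∀ l, l ≠ k → r l (m l) < r l y).exists_max_image
      (r k) ⟨y0, by
        simp only [Finset.mem_filter, Finset.mem_univ, true_and]
        intro l hl
        obtain ⟨b, hb, hlt⟩ := hy0 l hl
        exact (hm l b hb).trans_lt hlt⟩
    simp only [Finset.mem_filter, Finset.mem_univ, true_and] at hx hx'
    exact ⟨x, hx, hx'⟩
  choose X1 hX1 hX2 using hx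
  have hlek : ∀ k y, (∀ l, l ≠ k → r l (m l) < r l y) → r k y ≤ r k (m k) := by
    intro k y hy
    obtain ⟨l, hl⟩ := hB y
    by_cases hlk : l = k
    · subst hlk; exact hl _ (hmB l)
    · exact absurd (hl _ (hmB l)) (not_le.2 (hy l hlk))
  have hgood : ∀ k k', k ≠ k' → m k = m k' → X1 k ∉ B ∧ SDom r (insert (X1 k) B) := by
    intro k k' hkk' hmk
    constructor
    · intro hmem
      obtain ⟨l, hl⟩ := hsurj _ hmem
      by_cases hlk : l = k
      · subst hlk
        have := hX1 l k' hkk'.symm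
        rw [← hl, hmk] at this
        exact lt_irrefl _ this
      · have := hX1 k l hlk
        rw [hl] at this
        exact lt_irrefl _ this
    · intro y
      by_cases hy : ∀ l, l ≠ k → r l (m l) < r l y
      · refine ⟨k, fun x hx => ?_⟩
        rcases Finset.mem_insert.1 hx with rfl | hx
        · exact hX2 k y hy
        · exact (hlek k y hy).trans (hm k x hx)
      · push Not at hy
        obtain ⟨l, hlk, hl⟩ := hy
        refine ⟨l, fun x hx => ?_⟩
        rcases Finset.mem_insert.1 hx with rfl | hx
        · exact hl.trans (hX1 k l hlk).le
        · exact hl.trans (hm l x hx)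
  have hXne : X1 i ≠ X1 j := by
    intro h
    obtain ⟨l, hl⟩ := hB (X1 i)
    have h2 := hl _ (hmB l)
    by_cases hli : l = i
    · have := hX1 j l (by rw [hli]; exact hij)
      rw [← h] at this
      exact absurd h2 (not_le.2 this)
    · exact absurd h2 (not_le.2 (hX1 i l hli))
  have : S = {X1 i, X1 j} := by
    ext x
    rw [hS]
    simp only [Finset.mem_insert, Finset.mem_singleton]
    constructor
    · rintro ⟨hxB, hD⟩
      -- x is the minimum for some k
      obtain ⟨k, hk⟩ := hD x
      have hlt : ∀ l, l ≠ k → r l (m l) < r l x := by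
        intro l hl
        by_contra hcon
        push Not at hcon
        -- then every element of B is m of an index other than k and l
        have hall : ∀ b ∈ B, ∃ a, a ≠ k ∧ a ≠ l ∧ m a = b := by
          intro b hb
          obtain ⟨a, ha⟩ := hD b
          have hxa := ha x (Finset.mem_insert_self _ _)
          refine ⟨a, ?_, ?_, ?_⟩
          · rintro rfl
            have := hinj a (le_antisymm hxa (hk b (Finset.mem_insert_of_mem hb)))
            exact hxB (this ▸ hb)
          · rintro rfl
            have := hinj a (le_antisymm hxa (hcon.trans (hm a b hb)))
            exact hxB (this ▸ hb)
          · exact hinj a (le_antisymm (hm a b hb)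
              (ha _ (Finset.mem_insert_of_mem (hmB a))))
        have hsub : B ⊆ ((Finset.univ.erase k).erase l).image m := by
          intro b hb
          obtain ⟨a, h1, h2, h3⟩ := hall b hb
          exact Finset.mem_image.2 ⟨a, by simp [h1, h2], h3⟩
        have h1 := (Finset.card_le_card hsub).trans Finset.card_image_le
        rw [Finset.card_erase_of_mem (by simp [hl]), Finset.card_erase_of_mem (by simp),
          Finset.card_univ] at h1
        have : 0 < B.card := hne.card_pos
        omega
      have hxk : x = X1 k := by
        apply hinj k
        refine le_antisymm (hX2 k x hlt) ?_
        obtain ⟨l, hl⟩ := hD (X1 k)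
        by_cases hlk : l = k
        · subst hlk; exact hl x (Finset.mem_insert_self _ _)
        · exact absurd (hl _ (Finset.mem_insert_of_mem (hmB l))) (not_le.2 (hX1 k l hlk))
      have hkk : k = i ∨ k = j := by
        by_contra hcon
        push Not at hcon
        -- m k is attained by a different index
        obtain ⟨a, ha⟩ := hD (m k)
        have hak : a ≠ k := by
          rintro rfl
          have h1 := ha x (Finset.mem_insert_self _ _)
          have := hinj a (le_antisymm h1 (hk _ (Finset.mem_insert_of_mem (hmB a))))
          exact hxB (this ▸ hmB a)
        have hma : m k = m a := hinj a (le_antisymm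
          (ha _ (Finset.mem_insert_of_mem (hmB a))) (hm a _ (hmB k)))
        exact hij (hinjoff k a hak.symm hma i j hcon.1.symm hcon.2.symm hmij)
      rcases hkk with rfl | rfl
      · exact Or.inl hxk
      · exact Or.inr hxk
    · rintro (rfl | rfl)
      · exact hgood i j hij hmij
      · exact hgood j i hij.symm hmij.symm
  rw [this, Finset.card_pair hXne]

theorem scarf_room {X I : Type*} [Fintype X] [Fintype I] [DecidableEq X] [DecidableEq I] (c : X → I) (i0 : I) (R : Finset X)
    (hcard : R.card = Fintype.card I) (hR : ¬ ∀ i, ∃ x ∈ R, c x = i) :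
    Even (R.filter fun x => (R.erase x).image c = Finset.univ.erase i0).card := by
  by_cases hemp : (R.filter fun x => (R.erase x).image c = Finset.univ.erase i0) = ∅
  · rw [hemp]; simp
  obtain ⟨x, hx⟩ := Finset.nonempty_iff_ne_empty.2 hemp
  obtain ⟨hxR, hx⟩ := Finset.mem_filter.1 hx
  have hcx : c x ≠ i0 := by
    rintro h
    apply hR
    intro i
    by_cases hi : i = i0
    · exact ⟨x, hxR, by rw [h, hi]⟩
    · have : i ∈ (R.erase x).image c := by rw [hx]; simp [hi]
      obtain ⟨z, hz, rfl⟩ := Finset.mem_image.1 this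
      exact ⟨z, Finset.mem_of_mem_erase hz, rfl⟩
  have : c x ∈ (R.erase x).image c := by rw [hx]; simp [hcx]
  obtain ⟨x', hx', hcx'⟩ := Finset.mem_image.1 this
  have hx'x := Finset.ne_of_mem_erase hx'
  have hx'R := Finset.mem_of_mem_erase hx'
  have hinj : Set.InjOn c (R.erase x : Finset X) := by
    apply Finset.card_image_iff.1
    rw [hx, Finset.card_erase_of_mem (Finset.mem_univ _), Finset.card_univ,
      Finset.card_erase_of_mem hxR, hcard]
  have : (R.filter fun x => (R.erase x).image c = Finset.univ.erase i0) = {x, x'} := by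
    ext z
    simp only [Finset.mem_filter, Finset.mem_insert, Finset.mem_singleton]
    constructor
    · rintro ⟨hzR, hz⟩
      by_contra hcon
      push Not at hcon
      have hinj' : Set.InjOn c (R.erase z : Finset X) := by
        apply Finset.card_image_iff.1
        rw [hz, Finset.card_erase_of_mem (Finset.mem_univ _), Finset.card_univ,
          Finset.card_erase_of_mem hzR, hcard]
      exact hx'x (hinj' (by simp [hx'R, hcon.2.symm]) (by simp [hxR, hcon.1.symm]) hcx')
    · rintro (rfl | rfl)
      · exact ⟨hxR, hx⟩
      · refine ⟨hx'R, ?_⟩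
        rw [← hx]
        ext i
        simp only [Finset.mem_image, Finset.mem_erase]
        constructor
        · rintro ⟨a, ⟨h1, h2⟩, rfl⟩
          by_cases hax : a = x
          · exact ⟨z, ⟨hx'x, hx'R⟩, by rw [hax, hcx']⟩
          · exact ⟨a, ⟨hax, h2⟩, rfl⟩
        · rintro ⟨a, ⟨h1, h2⟩, rfl⟩
          by_cases hax : a = z
          · exact ⟨x, ⟨hx'x.symm, hxR⟩, by rw [hax, hcx']⟩
          · exact ⟨a, ⟨hax, h2⟩, rfl⟩
  rw [this, Finset.card_pair hx'x.symm]
  exact even_two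

theorem scarf {T I α : Type*} [LinearOrder α] [Fintype T] [Fintype I] [Nonempty T] [Nonempty I]
    (r : I → T ⊕ I → α) (hinj : ∀ i, Function.Injective (r i))
    (h1 : ∀ i t, r i (Sum.inr i) < r i (Sum.inl t))
    (h2 : ∀ i j t, j ≠ i → r i (Sum.inl t) < r i (Sum.inr j)) (c : T → I) :
    ∃ B : Finset (T ⊕ I), SDom r B ∧ ∀ i, ∃ x ∈ B, Sum.elim c id x = i := by
  classical
  by_contra hcon
  push Not at hcon
  obtain ⟨i0⟩ := ‹Nonempty I›
  obtain ⟨t0⟩ := ‹Nonempty T›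
  set c' : T ⊕ I → I := Sum.elim c id with hc'
  set rooms : Finset (Finset (T ⊕ I)) :=
    Finset.univ.filter fun R => SDom r R ∧ R.card = Fintype.card I with hrooms
  set doors : Finset (Finset (T ⊕ I)) :=
    Finset.univ.filter fun D => SDom r D ∧ D.card + 1 = Fintype.card I ∧
      D.image c' = Finset.univ.erase i0 with hdoors
  set f : Finset (T ⊕ I) → Finset (T ⊕ I) := fun D =>
    Finset.univ.filter fun x => x ∉ D ∧ SDom r (insert x D) with hf
  set g : Finset (T ⊕ I) → Finset (T ⊕ I) := fun R =>
    R.filter fun x => (R.erase x).image c' = Finset.univ.erase i0 with hg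
  have hbij : (doors.sigma f).card = (rooms.sigma g).card := by
    refine Finset.card_nbij' (fun p => ⟨insert p.2 p.1, p.2⟩) (fun p => ⟨p.1.erase p.2, p.2⟩)
      ?_ ?_ ?_ ?_
    · rintro ⟨D, x⟩ h
      simp only [Finset.coe_sigma, Set.mem_sigma_iff, Finset.mem_coe, hdoors, hf, hrooms, hg,
        Finset.mem_filter, Finset.mem_univ, true_and] at h ⊢
      obtain ⟨⟨ha, hb, hc⟩, hd, he⟩ := h
      exact ⟨⟨he, by rw [Finset.card_insert_of_notMem hd, hb]⟩, Finset.mem_insert_self _ _,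
        by rw [Finset.erase_insert hd, hc]⟩
    · rintro ⟨R, x⟩ h
      simp only [Finset.coe_sigma, Set.mem_sigma_iff, Finset.mem_coe, hdoors, hf, hrooms, hg,
        Finset.mem_filter, Finset.mem_univ, true_and] at h ⊢
      obtain ⟨⟨ha, hb⟩, hd, he⟩ := h
      refine ⟨⟨ha.mono (Finset.erase_subset _ _), ?_, he⟩, Finset.notMem_erase _ _, ?_⟩
      · rw [← hb, Finset.card_erase_add_one hd]
      · rwa [Finset.insert_erase hd]
    · rintro ⟨D, x⟩ h
      simp only [Finset.coe_sigma, Set.mem_sigma_iff, Finset.mem_coe, hdoors, hf,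
        Finset.mem_filter, Finset.mem_univ, true_and] at h
      simp [Finset.erase_insert h.2.1]
    · rintro ⟨R, x⟩ h
      simp only [Finset.coe_sigma, Set.mem_sigma_iff, Finset.mem_coe, hrooms, hg,
        Finset.mem_filter, Finset.mem_univ, true_and] at h
      simp [Finset.insert_erase h.2.1]
  rw [Finset.card_sigma, Finset.card_sigma] at hbij
  have heven : Even (∑ R ∈ rooms, (g R).card) := by
    apply Finset.even_sum
    intro R hR
    simp only [hrooms, Finset.mem_filter, Finset.mem_univ, true_and] at hR
    have hno : ¬ ∀ i, ∃ x ∈ R, c' x = i := by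
      obtain ⟨i, hi⟩ := hcon R hR.1
      push Not
      exact ⟨i, hi⟩
    exact scarf_room c' i0 R hR.2 hno
  set D0 : Finset (T ⊕ I) := (Finset.univ.erase i0).image Sum.inr with hD0
  have hmem0 : ∀ i, Sum.inr i ∈ D0 ↔ i ≠ i0 := by intro i; simp [hD0]
  have hmem0' : ∀ t, Sum.inl t ∉ D0 := by intro i; simp [hD0]
  have h3 : ∀ i x, r i (Sum.inr i) ≤ r i x := by
    intro i x
    rcases x with t | j
    · exact (h1 i t).le
    · by_cases hj : j = i
      · rw [hj]
      · exact ((h1 i t0).trans (h2 i j t0 hj)).le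
  have hD0door : D0 ∈ doors := by
    simp only [hdoors, Finset.mem_filter, Finset.mem_univ, true_and]
    refine ⟨?_, ?_, ?_⟩
    · rintro (t | j)
      · refine ⟨i0, ?_⟩
        rintro (s | l) hx
        · exact absurd hx (hmem0' s)
        · exact (h2 i0 l t ((hmem0 l).1 hx)).le
      · exact ⟨j, fun x _ => h3 j x⟩
    · rw [hD0, Finset.card_image_of_injective _ Sum.inr_injective,
        Finset.card_erase_add_one (Finset.mem_univ _), Finset.card_univ]
    · ext i; simp [hD0, hc']
  have hf0 : (f D0).card = 1 := by
    obtain ⟨tm, -, htm⟩ := (Finset.univ : Finset T).exists_max_image (fun t => r i0 (Sum.inl t))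
      ⟨t0, Finset.mem_univ _⟩
    rw [Finset.card_eq_one]
    refine ⟨Sum.inl tm, ?_⟩
    ext x
    simp only [hf, Finset.mem_filter, Finset.mem_univ, true_and, Finset.mem_singleton]
    constructor
    · rintro ⟨hx, hD⟩
      rcases x with t | j
      · obtain ⟨i, hi⟩ := hD (Sum.inl tm)
        by_cases hii : i = i0
        · subst hii
          exact hinj i (le_antisymm (htm t (Finset.mem_univ _)) (hi _ (Finset.mem_insert_self _ _)))
        · exact absurd (hi (Sum.inr i) (Finset.mem_insert_of_mem ((hmem0 i).2 hii)))
            (not_le.2 (h1 i tm))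
      · have hj : j = i0 := by
          by_contra h
          exact hx ((hmem0 j).2 h)
        obtain ⟨i, hi⟩ := hD (Sum.inl t0)
        have : Sum.inr i ∈ insert (Sum.inr j) D0 := by
          by_cases hii : i = i0
          · rw [hii, hj]; exact Finset.mem_insert_self _ _
          · exact Finset.mem_insert_of_mem ((hmem0 i).2 hii)
        exact absurd (hi _ this) (not_le.2 (h1 i t0))
    · rintro rfl
      refine ⟨hmem0' _, ?_⟩
      rintro (t | j)
      · refine ⟨i0, fun x hx => ?_⟩
        rcases Finset.mem_insert.1 hx with rfl | hx
        · exact htm t (Finset.mem_univ _)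
        · rcases x with s | l
          · exact absurd hx (hmem0' s)
          · exact (h2 i0 l t ((hmem0 l).1 hx)).le
      · exact ⟨j, fun x _ => h3 j x⟩
  have hodd : Odd (∑ D ∈ doors, (f D).card) := by
    rw [← Finset.sum_erase_add _ _ hD0door, hf0]
    refine Even.add_one (Finset.even_sum _ fun D hD => ?_)
    obtain ⟨hne, hD⟩ := Finset.mem_erase.1 hD
    simp only [hdoors, Finset.mem_filter, Finset.mem_univ, true_and] at hD
    obtain ⟨ha, hb, hc⟩ := hD
    have ⟨s, hs⟩ : ∃ s, Sum.inl s ∈ D := by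
      by_contra hno
      push Not at hno
      apply hne
      ext x
      rcases x with t | j
      · exact iff_of_false (hno t) (hmem0' t)
      · rw [hmem0]
        have : j ∈ D.image c' ↔ j ≠ i0 := by rw [hc]; simp
        rw [← this]
        constructor
        · intro h; exact Finset.mem_image.2 ⟨_, h, rfl⟩
        · intro h
          obtain ⟨x, hx, hxj⟩ := Finset.mem_image.1 h
          rcases x with t | l
          · exact absurd hx (hno t)
          · simp only [hc', Sum.elim_inr, id] at hxj
            rwa [← hxj]
    have h2' := scarf_pivot r hinj D ha ⟨_, hs⟩ hb fun k =>
      ⟨Sum.inr k, fun l hl => ⟨_, hs, h2 l k s hl.symm⟩⟩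
    have h2'' : (f D).card = 2 := h2' (f D) fun x => by
      simp only [hf, Finset.mem_filter, Finset.mem_univ, true_and]
    rw [h2'']
    exact even_two
  rw [hbij] at hodd
  exact Nat.not_even_iff_odd.2 hodd heven

/-- Approximate form of the labelling argument on a finite net of the simplex. -/
theorem simplex_net {I : Type*} [Fintype I] [Nonempty I] (ε : ℝ) (hε : 0 < ε)
    (T : Finset (I → ℝ)) (hT : ∀ t ∈ T, t ∈ stdSimplex ℝ I)
    (hnet : ∀ z ∈ stdSimplex ℝ I, ∃ t ∈ T, ∀ i, |z i - t i| < ε) (c : (I → ℝ) → I) :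
    ∃ t0 ∈ T, ∀ i, (∃ t ∈ T, c t = i ∧ ∀ j, |t j - t0 j| ≤ Fintype.card I * ε) ∨
      t0 i ≤ Fintype.card I * ε := by
  classical
  have hTne : Nonempty T := by
    obtain ⟨i⟩ := ‹Nonempty I›
    obtain ⟨t, ht, -⟩ := hnet _ (single_mem_stdSimplex ℝ i)
    exact ⟨⟨t, ht⟩⟩
  let e := Fintype.equivFin (T ⊕ I)
  let val : I → T ⊕ I → ℝ := fun i => Sum.elim (fun t => t.1 i) (fun j => if j = i then -1 else 2)
  let r : I → T ⊕ I → ℝ ×ₗ (Fin (Fintype.card (T ⊕ I))) := fun i x => toLex (val i x, e x)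
  have hlt : ∀ i x y, val i x < val i y → r i x < r i y := fun i x y h =>
    Prod.Lex.toLex_lt_toLex.2 (Or.inl h)
  have hle : ∀ i x y, r i x ≤ r i y → val i x ≤ val i y := by
    intro i x y h
    by_contra hcon
    exact absurd h (not_le.2 (hlt i y x (not_le.1 hcon)))
  have h01 : ∀ (t : T) i, 0 ≤ t.1 i ∧ t.1 i ≤ 1 := fun t i =>
    mem_Icc_of_mem_stdSimplex (hT _ t.2) i
  have hr1 : ∀ i (t : T), r i (Sum.inr i) < r i (Sum.inl t) := by
    intro i t
    apply hlt
    simp only [val, Sum.elim_inr, Sum.elim_inl, if_true]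
    linarith [(h01 t i).1]
  obtain ⟨B, hB, hcol⟩ := scarf r
    (by
      intro i x y h
      have := congrArg (fun z => (ofLex z).2) h
      exact e.injective this)
    hr1
    (by
      intro i j t hj
      apply hlt
      simp only [val, Sum.elim_inr, Sum.elim_inl, if_neg hj]
      linarith [(h01 t i).2]) (fun t => c t.1)
  have hBT : ∃ t : T, Sum.inl t ∈ B := by
    by_contra hno
    push Not at hno
    obtain ⟨t⟩ := hTne
    obtain ⟨i, hi⟩ := hB (Sum.inl t)
    obtain ⟨x, hx, hxi⟩ := hcol i
    rcases x with s | j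
    · exact hno s hx
    · simp only [Sum.elim_inr, id] at hxi
      subst hxi
      exact absurd (hi _ hx) (not_le.2 (hr1 j t))
  obtain ⟨t0, ht0⟩ := hBT
  -- minima
  have hmin : ∀ i, ∃ s : T, Sum.inl s ∈ B ∧ ∀ t : T, Sum.inl t ∈ B → s.1 i ≤ t.1 i := by
    intro i
    obtain ⟨s, hs, hs'⟩ := (Finset.univ.filter fun t : T => Sum.inl t ∈ B).exists_min_image
      (fun t => t.1 i) ⟨t0, by simpa using ht0⟩
    simp only [Finset.mem_filter, Finset.mem_univ, true_and] at hs hs'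
    exact ⟨s, hs, hs'⟩
  choose s hsB hsmin using hmin
  let C : Finset I := Finset.univ.filter fun i => Sum.inr i ∉ B
  have hdom : ∀ t : T, ∃ i ∈ C, t.1 i ≤ (s i).1 i := by
    intro t
    obtain ⟨i, hi⟩ := hB (Sum.inl t)
    refine ⟨i, ?_, hle i _ _ (hi _ (hsB i))⟩
    simp only [C, Finset.mem_filter, Finset.mem_univ, true_and]
    intro h
    exact absurd (hi _ h) (not_le.2 (hr1 i t))
  have hCne : C.Nonempty := by
    obtain ⟨i, hi, -⟩ := hdom t0
    exact ⟨i, hi⟩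
  have hCpos : (0 : ℝ) < C.card := by exact_mod_cast hCne.card_pos
  have hCcard : (C.card : ℝ) ≤ Fintype.card I := by exact_mod_cast Finset.card_le_univ C
  have hn : ∀ t : T, Sum.inl t ∈ B → ∑ i ∈ C, (s i).1 i ≤ ∑ i ∈ C, t.1 i := fun t ht =>
    Finset.sum_le_sum fun i _ => hsmin i t ht
  have hsumC : ∀ t : T, ∑ i ∈ C, t.1 i ≤ 1 := fun t => by
    rw [← (hT _ t.2).2]
    exact Finset.sum_le_univ_sum_of_nonneg fun i => (h01 t i).1
  have hslack : 1 - ∑ i ∈ C, (s i).1 i < Fintype.card I * ε := by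
    by_contra hcon
    push Not at hcon
    set S := 1 - ∑ i ∈ C, (s i).1 i with hS
    have hS0 : 0 ≤ S := by have := (hn t0 ht0).trans (hsumC t0); linarith
    obtain ⟨t, ht, hnear⟩ := hnet (fun i => if i ∈ C then (s i).1 i + S / C.card else 0) (by
      constructor
      · intro i
        dsimp only
        split_ifs
        · have := (h01 (s i) i).1
          positivity
        · exact le_rfl
      · rw [Finset.sum_ite_mem, Finset.univ_inter, Finset.sum_add_distrib, Finset.sum_const,
          nsmul_eq_mul, mul_div_cancel₀ _ hCpos.ne']
        rw [hS]; ring)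
    obtain ⟨i, hiC, hi⟩ := hdom ⟨t, ht⟩
    have h1 := hnear i
    simp only [hiC, if_true] at h1
    have h2 : ε ≤ S / C.card := by
      rw [le_div_iff₀ hCpos]
      nlinarith
    have := (abs_lt.1 h1).2
    linarith
  have hone : ∀ t : T, ∑ i, t.1 i = 1 := fun t => (hT _ t.2).2
  have hout : ∀ t : T, Sum.inl t ∈ B → ∀ i, i ∉ C → t.1 i ≤ Fintype.card I * ε := by
    intro t ht i hi
    have h1 : t.1 i + ∑ j ∈ C, t.1 j ≤ 1 := by
      rw [← hone t, ← Finset.sum_insert hi]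
      exact Finset.sum_le_univ_sum_of_nonneg fun i => (h01 t i).1
    linarith [hn t ht]
  have hin : ∀ t : T, Sum.inl t ∈ B → ∀ i ∈ C, t.1 i ≤ (s i).1 i + Fintype.card I * ε := by
    intro t ht i hi
    have h1 : ∑ j ∈ C.erase i, (s j).1 j ≤ ∑ j ∈ C.erase i, t.1 j :=
      Finset.sum_le_sum fun j _ => hsmin j t ht
    have h2 := Finset.add_sum_erase C (fun j => t.1 j) hi
    have h3 := Finset.add_sum_erase C (fun j => (s j).1 j) hi
    linarith [hsumC t]
  refine ⟨t0.1, t0.2, fun i => ?_⟩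
  by_cases hiC : i ∈ C
  · left
    obtain ⟨x, hx, hxi⟩ := hcol i
    rcases x with t | j
    · refine ⟨t.1, t.2, hxi, fun j => ?_⟩
      by_cases hj : j ∈ C
      · have a1 := hin t hx j hj
        have a2 := hin t0 ht0 j hj
        have a3 := hsmin j t hx
        have a4 := hsmin j t0 ht0
        rw [abs_le]; constructor <;> linarith
      · have a1 := hout t hx j hj
        have a2 := hout t0 ht0 j hj
        have a3 := (h01 t j).1
        have a4 := (h01 t0 j).1
        rw [abs_le]; constructor <;> linarith
    · simp only [Sum.elim_inr, id] at hxi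
      subst hxi
      simp only [C, Finset.mem_filter, Finset.mem_univ, true_and] at hiC
      exact absurd hx hiC
  · exact Or.inr (hout t0 ht0 i hiC)

/-- Brouwer's theorem on the standard simplex. -/
theorem brouwer_simplex {I : Type*} [Fintype I] [Nonempty I] (g : (I → ℝ) → (I → ℝ))
    (hg : ContinuousOn g (stdSimplex ℝ I)) (hmaps : ∀ x ∈ stdSimplex ℝ I, g x ∈ stdSimplex ℝ I) :
    ∃ x ∈ stdSimplex ℝ I, g x = x := by
  classical
  have hcomp : IsCompact (stdSimplex ℝ I) := isCompact_stdSimplex ℝ I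
  -- labels
  have hlab : ∀ x : I → ℝ, ∃ i, x ∈ stdSimplex ℝ I → x i ≤ g x i := by
    intro x
    by_contra hcon
    push Not at hcon
    obtain ⟨i0⟩ := ‹Nonempty I›
    have hx := (hcon i0).1
    have : ∑ i, g x i < ∑ i, x i :=
      Finset.sum_lt_sum_of_nonempty ⟨i0, Finset.mem_univ _⟩ fun i _ => (hcon i).2
    rw [hx.2, (hmaps x hx).2] at this
    exact lt_irrefl _ this
  choose c hc using hlab
  have happrox : ∀ δ > 0, ∃ x ∈ stdSimplex ℝ I, ∀ i, x i - g x i ≤ δ := by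
    intro δ hδ
    have huc := hcomp.uniformContinuousOn_of_continuous hg
    obtain ⟨η, hη, hη'⟩ := Metric.uniformContinuousOn_iff.1 huc (δ / 2) (by linarith)
    set n : ℝ := (Fintype.card I : ℝ) with hn
    have hnpos : 0 < n := by rw [hn]; exact_mod_cast Fintype.card_pos
    set ε := min (η / 2) (δ / 2) / n with hε
    have hεpos : 0 < ε := by positivity
    have hnε : n * ε = min (η / 2) (δ / 2) := by rw [hε]; field_simp
    obtain ⟨T, hTsub, hTfin, hTcov⟩ := hcomp.totallyBounded.exists_subset
      (Metric.dist_mem_uniformity hεpos)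
    obtain ⟨x, hx, hxi⟩ := simplex_net ε hεpos hTfin.toFinset
      (fun t ht => hTsub (by simpa using ht)) (by
        intro z hz
        have := hTcov hz
        simp only [mem_iUnion] at this
        obtain ⟨t, ht, hzt⟩ := this
        refine ⟨t, by simpa using ht, fun i => ?_⟩
        rw [← Real.dist_eq]
        exact (dist_le_pi_dist z t i).trans_lt hzt) c
    have hxS : x ∈ stdSimplex ℝ I := hTsub (by simpa using hx)
    refine ⟨x, hxS, fun i => ?_⟩
    rcases hxi i with ⟨t, ht, hti, hd⟩ | h
    · have htS : t ∈ stdSimplex ℝ I := hTsub (by simpa using ht)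
      have h1 := hc t htS
      rw [hti] at h1
      have hdist : dist t x < η := by
        have : dist t x ≤ n * ε := (dist_pi_le_iff (by positivity)).2 fun j => by
          rw [Real.dist_eq]; exact hd j
        rw [hnε] at this
        have := this.trans (min_le_left _ _)
        linarith
      have h2 := (dist_le_pi_dist (g t) (g x) i).trans_lt (hη' t htS x hxS hdist)
      rw [Real.dist_eq] at h2
      have h3 := hd i
      rw [← hn, hnε] at h3
      have h3 := h3.trans (min_le_right _ _)
      have := (abs_lt.1 h2).2
      have := (abs_le.1 h3).1
      linarith
    · rw [← hn, hnε] at h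
      have := h.trans (min_le_right _ _)
      have := (hmaps x hxS).1 i
      linarith
  -- pass to the limit
  have hcont : ContinuousOn (fun x => ∑ i, max 0 (x i - g x i)) (stdSimplex ℝ I) := by
    apply continuousOn_finsetSum
    intro i _
    exact ContinuousOn.sup continuousOn_const ((continuous_apply i).continuousOn.sub
      ((continuous_apply i).comp_continuousOn hg))
  obtain ⟨i0⟩ := ‹Nonempty I›
  obtain ⟨x, hx, hxmin⟩ := hcomp.exists_isMinOn ⟨_, single_mem_stdSimplex ℝ i0⟩ hcont
  refine ⟨x, hx, ?_⟩
  have hle0 : ∑ i, max 0 (x i - g x i) ≤ 0 := by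
    apply le_of_forall_pos_le_add
    intro δ hδ
    have hnpos : (0 : ℝ) < Fintype.card I := by
      exact_mod_cast Fintype.card_pos_iff.2 ⟨i0⟩
    obtain ⟨z, hz, hzi⟩ := happrox (δ / Fintype.card I) (by positivity)
    have h1 : ∑ i, max 0 (x i - g x i) ≤ ∑ i, max 0 (z i - g z i) := hxmin hz
    refine h1.trans ?_
    refine (Finset.sum_le_card_nsmul Finset.univ _ (δ / Fintype.card I)
      fun i _ => max_le (by positivity) (hzi i)).trans ?_
    rw [Finset.card_univ, nsmul_eq_mul, mul_div_cancel₀ _ hnpos.ne', zero_add]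
  have hxle : ∀ i ∈ Finset.univ, x i ≤ g x i := by
    intro i _
    have h1 := Finset.single_le_sum (f := fun i => max 0 (x i - g x i))
      (fun i _ => le_max_left _ _) (Finset.mem_univ i)
    have h2 := le_max_right 0 (x i - g x i)
    linarith
  have hsum : ∑ i, x i = ∑ i, g x i := by rw [hx.2, (hmaps x hx).2]
  ext i
  exact ((Finset.sum_eq_sum_iff_of_le hxle).1 hsum i (Finset.mem_univ i)).symm

/-- Brouwer's theorem for bounded continuous self-maps of Euclidean space. -/
theorem brouwer_bounded {d : ℕ} (R : ℝ) (hR : 0 < R)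
    (h : EuclideanSpace ℝ (Fin d) → EuclideanSpace ℝ (Fin d)) (hc : Continuous h)
    (hb : ∀ x, ‖h x‖ ≤ R) : ∃ x, h x = x := by
  set a : ℝ := 2 * d * R + 1 with ha
  have hapos : 0 < a := by positivity
  let toE : (Option (Fin d) → ℝ) → EuclideanSpace ℝ (Fin d) := fun s =>
    WithLp.toLp 2 fun i => a * s (some i) - R
  let inv : EuclideanSpace ℝ (Fin d) → (Option (Fin d) → ℝ) := fun x o =>
    o.elim (1 - ∑ i, (x i + R) / a) (fun i => (x i + R) / a)
  have htoE : Continuous toE := by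
    apply (PiLp.continuous_toLp 2 _).comp
    fun_prop
  have hinv : Continuous inv := by
    apply continuous_pi
    rintro (_ | i)
    · simp only [inv, Option.elim]; fun_prop
    · simp only [inv, Option.elim]; fun_prop
  have hti : ∀ x, toE (inv x) = x := by
    intro x
    ext i
    simp only [toE, inv, Option.elim]
    field_simp
    ring
  have hcoord : ∀ x i, |h x i| ≤ R := fun x i =>
    (Real.norm_eq_abs _ ▸ PiLp.norm_apply_le (h x) i).trans (hb x)
  have hmem : ∀ x, inv (h x) ∈ stdSimplex ℝ (Option (Fin d)) := by
    intro x
    have hsum : ∑ i, (h x i + R) / a ≤ 1 := by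
      rw [← Finset.sum_div, div_le_one hapos]
      have : ∑ i, (h x i + R) ≤ ∑ i : Fin d, (2 * R) := Finset.sum_le_sum fun i _ => by
        linarith [(abs_le.1 (hcoord x i)).2]
      rw [Finset.sum_const, Finset.card_univ, Fintype.card_fin, nsmul_eq_mul] at this
      rw [ha]; linarith
    constructor
    · rintro (_ | i)
      · simp only [inv, Option.elim]; linarith
      · simp only [inv, Option.elim]
        have := (abs_le.1 (hcoord x i)).1
        apply div_nonneg _ hapos.le
        linarith
    · rw [Fintype.sum_option]
      simp [inv]
  obtain ⟨s, -, hs⟩ := brouwer_simplex (fun s => inv (h (toE s)))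
    (hinv.comp (hc.comp htoE)).continuousOn (fun s _ => hmem _)
  refine ⟨toE s, ?_⟩
  rw [← hti (h (toE s))]
  exact congrArg toE hs

/-- A continuous field which does not point inwards on a sphere has a zero in the ball. -/
theorem exists_zero_of_inner {d : ℕ} (R : ℝ) (hR : 0 < R)
    (F : EuclideanSpace ℝ (Fin d) → EuclideanSpace ℝ (Fin d)) (hc : Continuous F)
    (hF : ∀ x, ‖x‖ = R → 0 ≤ inner ℝ (F x) x) : ∃ x, ‖x‖ ≤ R ∧ F x = 0 := by
  have hmax : ∀ x : EuclideanSpace ℝ (Fin d), 0 < max R ‖x‖ := fun x => lt_max_of_lt_left hR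
  obtain ⟨x, hx⟩ := brouwer_bounded R hR (fun x => (R / max R ‖x - F x‖) • (x - F x))
    (by
      refine Continuous.fun_smul ?_ ?_
      · apply continuous_const.div
        · fun_prop
        · intro x; exact (hmax _).ne'
      · fun_prop)
    (by
      intro x
      rw [norm_smul, Real.norm_of_nonneg (by have := hmax (x - F x); positivity),
        div_mul_eq_mul_div, div_le_iff₀ (hmax _)]
      exact mul_le_mul_of_nonneg_left (le_max_right _ _) hR.le)
  rcases le_or_gt ‖x - F x‖ R with h | h
  · rw [max_eq_left h, div_self hR.ne', one_smul] at hx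
    have h0 : F x = 0 := by simpa using hx
    rw [h0, sub_zero] at h
    exact ⟨x, h, h0⟩
  · exfalso
    rw [max_eq_right h.le] at hx
    have hN : 0 < ‖x - F x‖ := hR.trans h
    have hxR : ‖x‖ = R := by
      conv_lhs => rw [← hx]
      rw [norm_smul, Real.norm_of_nonneg (by positivity)]
      field_simp
    have h1 : x - F x = (‖x - F x‖ / R) • x := by
      have h5 : (‖x - F x‖ / R) • ((R / ‖x - F x‖) • (x - F x)) = x - F x := by
        rw [smul_smul, div_mul_div_cancel₀ hR.ne', div_self hN.ne', one_smul]
      rw [hx] at h5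
      exact h5.symm
    have h2 : F x = (1 - ‖x - F x‖ / R) • x := by
      rw [sub_smul, one_smul, ← h1]; simp
    have h3 := hF x hxR
    rw [h2, real_inner_smul_left, real_inner_self_eq_norm_sq, hxR] at h3
    have h4 : 1 < ‖x - F x‖ / R := (one_lt_div hR).2 h
    have : 0 < R ^ 2 := by positivity
    nlinarith

/-- Coordinates relative to a grid point, extended by a zero coordinate. -/
noncomputable def relCoord {d : ℕ} (h : ℝ) (v : Fin d → ℤ) (x : EuclideanSpace ℝ (Fin d))
    (o : Option (Fin d)) : ℝ :=
  o.elim 0 fun i => x i / h - v i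

/-- A bump function on the open star of a grid point in the Freudenthal triangulation. -/
noncomputable def gridHat {d : ℕ} (h : ℝ) (v : Fin d → ℤ) (x : EuclideanSpace ℝ (Fin d)) : ℝ :=
  ∏ o : Option (Fin d), ∏ o' : Option (Fin d), max 0 (1 - (relCoord h v x o - relCoord h v x o'))

theorem continuous_gridHat {d : ℕ} (h : ℝ) (v : Fin d → ℤ) : Continuous (gridHat h v) := by
  have hrel : ∀ o, Continuous fun x => relCoord h v x o := by
    rintro (_ | i)
    · exact continuous_const
    · simp only [relCoord, Option.elim]
      fun_prop
  unfold gridHat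
  refine continuous_finsetProd _ fun o _ => continuous_finsetProd _ fun o' _ => ?_
  exact continuous_const.max (continuous_const.sub ((hrel o).sub (hrel o')))

theorem gridHat_nonneg {d : ℕ} (h : ℝ) (v : Fin d → ℤ) (x : EuclideanSpace ℝ (Fin d)) :
    0 ≤ gridHat h v x :=
  Finset.prod_nonneg fun _ _ => Finset.prod_nonneg fun _ _ => le_max_left _ _

theorem gridHat_pos_iff {d : ℕ} (h : ℝ) (v : Fin d → ℤ) (x : EuclideanSpace ℝ (Fin d)) :
    0 < gridHat h v x ↔ ∀ o o', relCoord h v x o - relCoord h v x o' < 1 := by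
  constructor
  · intro hpos o o'
    by_contra hcon
    push Not at hcon
    apply hpos.ne'
    refine Finset.prod_eq_zero (Finset.mem_univ o) (Finset.prod_eq_zero (Finset.mem_univ o') ?_)
    exact max_eq_left (by linarith)
  · intro hall
    refine Finset.prod_pos fun o _ => Finset.prod_pos fun o' _ => lt_max_of_lt_right ?_
    linarith [hall o o']

/-- The colour of a grid point: the sum of its coordinates modulo `d + 1`. -/
def gridColor {d : ℕ} (v : Fin d → ℤ) : Fin (d + 1) :=
  (((∑ i, v i : ℤ) : ZMod (d + 1)))

theorem gridColor_inj {d : ℕ} (h : ℝ) (v w : Fin d → ℤ) (x : EuclideanSpace ℝ (Fin d))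
    (hv : 0 < gridHat h v x) (hw : 0 < gridHat h w x) (hc : gridColor v = gridColor w) :
    v = w := by
  rw [gridHat_pos_iff] at hv hw
  have hdiff : ∀ i j, (w i - v i) - (w j - v j) ≤ 1 := by
    intro i j
    have h1 := hv (some i) (some j)
    have h2 := hw (some j) (some i)
    simp only [relCoord, Option.elim] at h1 h2
    have : (((w i - v i) - (w j - v j) : ℤ) : ℝ) < 2 := by push_cast; linarith
    have : (w i - v i) - (w j - v j) < 2 := by exact_mod_cast this
    omega
  have hone : ∀ i, w i - v i ≤ 1 ∧ -1 ≤ w i - v i := by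
    intro i
    have h1 := hv (some i) none
    have h2 := hw none (some i)
    have h3 := hv none (some i)
    have h4 := hw (some i) none
    simp only [relCoord, Option.elim] at h1 h2 h3 h4
    have h5 : ((w i - v i : ℤ) : ℝ) < 2 := by push_cast; linarith
    have h6 : ((-2 : ℤ) : ℝ) < ((w i - v i : ℤ) : ℝ) := by push_cast; linarith
    have h5 : w i - v i < 2 := by exact_mod_cast h5
    have h6 : -2 < w i - v i := by exact_mod_cast h6
    omega
  have hdvd : ((d + 1 : ℕ) : ℤ) ∣ ∑ i, (w i - v i) := by
    have hc' : ((∑ i, v i : ℤ) : ZMod (d + 1)) = ((∑ i, w i : ℤ) : ZMod (d + 1)) := hc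
    rw [ZMod.intCast_eq_intCast_iff_dvd_sub] at hc'
    rwa [Finset.sum_sub_distrib]
  have hle : ∑ i, (w i - v i) ≤ d := by
    have := Finset.sum_le_card_nsmul Finset.univ (fun i => w i - v i) 1 fun i _ => (hone i).1
    simpa using this
  have hge : -(d : ℤ) ≤ ∑ i, (w i - v i) := by
    have := Finset.card_nsmul_le_sum Finset.univ (fun i => w i - v i) (-1) fun i _ => (hone i).2
    simpa using this
  have hzero : ∑ i, (w i - v i) = 0 := by
    apply Int.eq_zero_of_abs_lt_dvd hdvd
    rw [abs_lt]
    push_cast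
    constructor <;> linarith
  by_cases hpos : ∀ i, 0 ≤ w i - v i
  · have := (Finset.sum_eq_zero_iff_of_nonneg fun i _ => hpos i).1 hzero
    ext i
    have := this i (Finset.mem_univ i)
    omega
  · push Not at hpos
    obtain ⟨j, hj⟩ := hpos
    have hneg : ∀ i, w i - v i ≤ 0 := fun i => by have := hdiff i j; omega
    have := (Finset.sum_eq_zero_iff_of_nonpos fun i _ => hneg i).1 hzero
    ext i
    have := this i (Finset.mem_univ i)
    omega

/-- The position of a grid point. -/
noncomputable def gridPt {d : ℕ} (h : ℝ) (v : Fin d → ℤ) : EuclideanSpace ℝ (Fin d) :=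
  WithLp.toLp 2 fun i => h * v i

theorem gridPt_near {d : ℕ} (h : ℝ) (hh : 0 < h) (v : Fin d → ℤ) (x : EuclideanSpace ℝ (Fin d))
    (hv : 0 < gridHat h v x) : ‖x - gridPt h v‖ ≤ h * (d + 1) := by
  rw [gridHat_pos_iff] at hv
  have hco : ∀ i, ‖(x - gridPt h v) i‖ ≤ h := by
    intro i
    have h1 := hv (some i) none
    have h2 := hv none (some i)
    simp only [relCoord, Option.elim] at h1 h2
    have h3 : (x - gridPt h v) i = h * (x i / h - v i) := by
      simp only [gridPt, PiLp.sub_apply]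
      field_simp
    rw [h3, norm_mul, Real.norm_of_nonneg hh.le, Real.norm_eq_abs]
    have : |x i / h - v i| ≤ 1 := by rw [abs_le]; constructor <;> linarith
    nlinarith
  rw [EuclideanSpace.norm_eq]
  apply Real.sqrt_le_iff.2
  refine ⟨by positivity, ?_⟩
  have h1 : ∑ i, ‖(x - gridPt h v) i‖ ^ 2 ≤ ∑ i : Fin d, h ^ 2 :=
    Finset.sum_le_sum fun i _ => pow_le_pow_left₀ (norm_nonneg _) (hco i) 2
  refine h1.trans ?_
  rw [Finset.sum_const, Finset.card_univ, Fintype.card_fin, nsmul_eq_mul, mul_pow, mul_comm]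
  apply mul_le_mul_of_nonneg_left _ (by positivity)
  have : (0 : ℝ) ≤ d := by positivity
  nlinarith

theorem gridHat_floor {d : ℕ} (h : ℝ) (x : EuclideanSpace ℝ (Fin d)) :
    0 < gridHat h (fun i => ⌊x i / h⌋) x := by
  rw [gridHat_pos_iff]
  have : ∀ o, 0 ≤ relCoord h (fun i => ⌊x i / h⌋) x o ∧
      relCoord h (fun i => ⌊x i / h⌋) x o < 1 := by
    rintro (_ | i)
    · simp [relCoord]
    · simp only [relCoord, Option.elim]
      exact ⟨by linarith [Int.floor_le (x i / h)], by linarith [Int.lt_floor_add_one (x i / h)]⟩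
  intro o o'
  linarith [(this o).2, (this o').1]

theorem komiya_approx {d : ℕ} (P : Set (EuclideanSpace ℝ (Fin d))) (hconv : Convex ℝ P)
    (hcomp : IsCompact P) (p : EuclideanSpace ℝ (Fin d)) (hp : p ∈ interior P)
    (A : Fin (d + 1) → Set (EuclideanSpace ℝ (Fin d)) → Set (EuclideanSpace ℝ (Fin d)))
    (y : Fin (d + 1) → Set (EuclideanSpace ℝ (Fin d)) → EuclideanSpace ℝ (Fin d))
    (hy : ∀ i τ, IsProperFace P τ → y i τ ∈ τ)
    (hcover : ∀ i, ∀ σ, IsFace P σ →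
      σ ⊆ ⋃ τ ∈ {τ | IsProperFace P τ ∧ τ ⊆ σ}, A i τ) (ε : ℝ) (hε : 0 < ε) :
    ∃ τ : Fin (d + 1) → Set (EuclideanSpace ℝ (Fin d)),
      ∃ x : Fin (d + 1) → EuclideanSpace ℝ (Fin d),
      (∀ i, IsProperFace P (τ i)) ∧
      p ∈ convexHull ℝ (Set.range fun i => y i (τ i)) ∧
      (∀ i, x i ∈ A i (τ i)) ∧ ∀ i j, dist (x i) (x j) ≤ ε := by
  classical
  have hpP : p ∈ P := interior_subset hp
  -- nearest point projection
  have hproj : ∀ u, ∃ r ∈ P, ∀ w ∈ P, inner ℝ (u - r) (w - r) ≤ 0 := by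
    intro u
    obtain ⟨r, hr, hr'⟩ := exists_norm_eq_iInf_of_complete_convex ⟨p, hpP⟩ hcomp.isComplete hconv u
    exact ⟨r, hr, (norm_eq_iInf_iff_real_inner_le_zero hconv hr).1 hr'⟩
  choose r hrP hr using hproj
  have hnonexp : ∀ a b, ‖r a - r b‖ ≤ ‖a - b‖ := by
    intro a b
    have h1 := hr a (r b) (hrP b)
    have h2 := hr b (r a) (hrP a)
    have h3 : ‖r a - r b‖ ^ 2 ≤ inner ℝ (a - b) (r a - r b) := by
      rw [← real_inner_self_eq_norm_sq]
      simp only [inner_sub_left, inner_sub_right] at h1 h2 ⊢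
      linarith
    have h4 := real_inner_le_norm (a - b) (r a - r b)
    by_contra hcon
    push Not at hcon
    have : 0 ≤ ‖a - b‖ := norm_nonneg _
    nlinarith
  obtain ⟨δ, hδ, hball⟩ := Metric.nhds_basis_closedBall.mem_iff.1 (mem_interior_iff_mem_nhds.1 hp)
  obtain ⟨D, hDpos, hD⟩ := hcomp.isBounded.exists_pos_norm_le
  -- labels
  have hlab : ∀ i u, ∃ τ, IsProperFace P τ ∧ r u ∈ A i τ ∧
      δ * ‖u - r u‖ ≤ inner ℝ (u - r u) (y i τ - p) := by
    intro i u
    by_cases hu : u - r u = 0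
    · have := hcover i P (Or.inr rfl) (hrP u)
      simp only [mem_iUnion, mem_ofPred_eq] at this
      obtain ⟨τ, ⟨hτ, -⟩, hmem⟩ := this
      exact ⟨τ, hτ, hmem, by simp [hu]⟩
    · have hun : 0 < ‖u - r u‖ := norm_pos_iff.2 hu
      set n := u - r u with hn
      have hdeep : δ * ‖n‖ ≤ inner ℝ n (r u - p) := by
        have hq : p + (δ / ‖n‖) • n ∈ P := by
          apply hball
          rw [mem_closedBall_iff_norm, add_sub_cancel_left, norm_smul,
            Real.norm_of_nonneg (by positivity), div_mul_cancel₀ _ hun.ne']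
        have h1 := hr u _ hq
        rw [← hn] at h1
        have h2 : p + (δ / ‖n‖) • n - r u = (δ / ‖n‖) • n - (r u - p) := by abel
        rw [h2, inner_sub_right, real_inner_smul_right, real_inner_self_eq_norm_sq] at h1
        have h3 : δ / ‖n‖ * ‖n‖ ^ 2 = δ * ‖n‖ := by field_simp
        linarith
      have hle : ∀ z ∈ P, inner ℝ n z ≤ inner ℝ n (r u) := by
        intro z hz
        have := hr u z hz
        rw [← hn, inner_sub_right] at this
        linarith
      let σ : Set (EuclideanSpace ℝ (Fin d)) := {z | z ∈ P ∧ inner ℝ n z = inner ℝ n (r u)}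
      have hσ : IsProperFace P σ := by
        refine ⟨⟨r u, hrP u, rfl⟩, ?_, ?_⟩
        · intro h
          have hp' : p ∈ σ := by rw [h]; exact hpP
          have h1 := hp'.2
          rw [inner_sub_right, h1, sub_self] at hdeep
          have : 0 < δ * ‖n‖ := by positivity
          linarith
        · refine ⟨fun z hz => hz.1, ?_⟩
          rintro a ha b hb z hz ⟨s, t, hs, ht, hst, rfl⟩
          refine ⟨ha, le_antisymm (hle a ha) ?_⟩
          have h1 := hz.2
          rw [inner_add_right, real_inner_smul_right, real_inner_smul_right] at h1
          have h2 := hle b hb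
          by_contra hcon
          push Not at hcon
          have h4 : t = 1 - s := by linarith
          subst h4
          nlinarith
      have := hcover i σ (Or.inl hσ) (show r u ∈ σ from ⟨hrP u, rfl⟩)
      simp only [mem_iUnion, mem_ofPred_eq] at this
      obtain ⟨τ, ⟨hτ, hsub⟩, hmem⟩ := this
      refine ⟨τ, hτ, hmem, ?_⟩
      have h1 := (hsub (hy i τ hτ)).2
      rw [inner_sub_right, h1, ← inner_sub_right]
      exact hdeep
  choose lab hlabF hlabA hlabI using hlab
  set h : ℝ := ε / (2 * (d + 1)) with hh
  have hhpos : 0 < h := by positivity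
  have hhε : h * (d + 1) = ε / 2 := by rw [hh]; field_simp
  set e := ε / 2 with he
  set R : ℝ := e + D + (e + D) * (2 * D) / δ + 1 with hRdef
  have hepos : 0 < e := by positivity
  have hRpos : 0 < R := by positivity
  let yy : (Fin d → ℤ) → EuclideanSpace ℝ (Fin d) := fun v =>
    y (gridColor v) (lab (gridColor v) (gridPt h v))
  have hyP : ∀ v, yy v ∈ P := fun v =>
    (hlabF (gridColor v) (gridPt h v)).2.2.subset (hy _ _ (hlabF _ _))
  set M : ℤ := ⌈R / h⌉ with hM
  let box : Finset (Fin d → ℤ) := Fintype.piFinset fun _ => Finset.Icc (-M) M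
  obtain ⟨x, hxR, hx0⟩ := exists_zero_of_inner R hRpos
    (fun x => ∑ v ∈ box, gridHat h v x • (yy v - p))
    (continuous_finsetSum _ fun v _ => (continuous_gridHat h v).smul continuous_const) (by
      intro x hx
      rw [sum_inner]
      refine Finset.sum_nonneg fun v _ => ?_
      rw [real_inner_smul_left]
      rcases (gridHat_nonneg h v x).eq_or_lt with h0 | h0
      · rw [← h0, zero_mul]
      · refine mul_nonneg h0.le ?_
        have hnear := gridPt_near h hhpos v x h0
        rw [hhε] at hnear
        set g := gridPt h v with hg
        have h1 : δ * ‖g - r g‖ ≤ inner ℝ (g - r g) (yy v - p) := hlabI _ _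
        have h2 : R ≤ e + ‖g - r g‖ + D := by
          rw [← hx]
          calc ‖x‖ = ‖(x - g) + (g - r g) + r g‖ := by congr 1; abel
            _ ≤ ‖x - g‖ + ‖g - r g‖ + ‖r g‖ := norm_add₃_le
            _ ≤ e + ‖g - r g‖ + D := by linarith [hD _ (hrP g)]
        have h3 : ‖(x - g) + r g‖ ≤ e + D :=
          (norm_add_le _ _).trans (by linarith [hD _ (hrP g)])
        have h4 : ‖yy v - p‖ ≤ 2 * D :=
          (norm_sub_le _ _).trans (by linarith [hD _ (hyP v), hD _ hpP])
        have h5 : -((e + D) * (2 * D)) ≤ inner ℝ ((x - g) + r g) (yy v - p) := by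
          have h6 := abs_real_inner_le_norm ((x - g) + r g) (yy v - p)
          have h7 : ‖(x - g) + r g‖ * ‖yy v - p‖ ≤ (e + D) * (2 * D) :=
            mul_le_mul h3 h4 (norm_nonneg _) (by positivity)
          linarith [(abs_le.1 (h6.trans h7)).1]
        have h8 : inner ℝ (yy v - p) x =
            inner ℝ (g - r g) (yy v - p) + inner ℝ ((x - g) + r g) (yy v - p) := by
          rw [← inner_add_left, real_inner_comm]
          congr 1
          abel
        have h9 : (e + D) * (2 * D) / δ ≤ ‖g - r g‖ := by linarith
        rw [div_le_iff₀ hδ] at h9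
        rw [h8]
        linarith)
  -- the vertices of the simplex containing `x`
  let S : Finset (Fin d → ℤ) := box.filter fun v => 0 < gridHat h v x
  have hv0 : (fun i => ⌊x i / h⌋) ∈ S := by
    refine Finset.mem_filter.2 ⟨?_, gridHat_floor h x⟩
    refine Fintype.mem_piFinset.2 fun i => ?_
    have h1 : |x i| ≤ R := (Real.norm_eq_abs _ ▸ PiLp.norm_apply_le x i).trans hxR
    have h2 : R / h ≤ M := Int.le_ceil _
    have h3 : |x i / h| ≤ M := by
      rw [abs_div, abs_of_pos hhpos]
      exact (div_le_div_of_nonneg_right h1 hhpos.le).trans h2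
    obtain ⟨h4, h5⟩ := abs_le.1 h3
    rw [Finset.mem_Icc]
    constructor
    · apply Int.le_floor.2
      push_cast
      exact h4
    · have : ((⌊x i / h⌋ : ℤ) : ℝ) ≤ M := (Int.floor_le _).trans h5
      exact_mod_cast this
  have hw : ∀ i : Fin (d + 1), ∃ v ∈ S, ∀ v' ∈ S, gridColor v' = i → v = v' := by
    intro i
    by_cases hex : ∃ v ∈ S, gridColor v = i
    · obtain ⟨v, hv, hvi⟩ := hex
      exact ⟨v, hv, fun v' hv' hvi' => gridColor_inj h v v' x (Finset.mem_filter.1 hv).2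
        (Finset.mem_filter.1 hv').2 (hvi.trans hvi'.symm)⟩
    · exact ⟨_, hv0, fun v' hv' hvi' => absurd ⟨v', hv', hvi'⟩ hex⟩
  choose w hwS hwu using hw
  refine ⟨fun i => lab i (gridPt h (w i)), fun i => r (gridPt h (w i)), fun i => hlabF _ _, ?_,
    fun i => hlabA _ _, fun i j => ?_⟩
  · have hx0' : ∑ v ∈ S, gridHat h v x • (yy v - p) = 0 := by
      rw [← hx0]
      refine Finset.sum_subset (Finset.filter_subset _ _) fun v hv hvS => ?_
      have : gridHat h v x = 0 := by
        by_contra hne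
        exact hvS (Finset.mem_filter.2 ⟨hv, lt_of_le_of_ne (gridHat_nonneg h v x) (Ne.symm hne)⟩)
      rw [this, zero_smul]
    have hW : 0 < ∑ v ∈ S, gridHat h v x :=
      Finset.sum_pos (fun v hv => (Finset.mem_filter.1 hv).2) ⟨_, hv0⟩
    have hpc : p = S.centerMass (fun v => gridHat h v x) yy := by
      have h1 : ∑ v ∈ S, gridHat h v x • yy v = (∑ v ∈ S, gridHat h v x) • p := by
        simp only [smul_sub, Finset.sum_sub_distrib] at hx0'
        rw [Finset.sum_smul]
        exact sub_eq_zero.1 hx0'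
      rw [Finset.centerMass, h1, smul_smul, inv_mul_cancel₀ hW.ne', one_smul]
    rw [hpc]
    refine Finset.centerMass_mem_convexHull _ (fun v _ => gridHat_nonneg h v x) hW ?_
    intro v hv
    refine ⟨gridColor v, ?_⟩
    simp only [yy]
    rw [hwu (gridColor v) v hv rfl]
  · rw [dist_eq_norm]
    refine (hnonexp _ _).trans ?_
    have h1 := gridPt_near h hhpos _ x (Finset.mem_filter.1 (hwS i)).2
    have h2 := gridPt_near h hhpos _ x (Finset.mem_filter.1 (hwS j)).2
    rw [hhε] at h1 h2
    calc ‖gridPt h (w i) - gridPt h (w j)‖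
        = ‖(x - gridPt h (w j)) - (x - gridPt h (w i))‖ := by congr 1; abel
      _ ≤ ‖x - gridPt h (w j)‖ + ‖x - gridPt h (w i)‖ := norm_sub_le _ _
      _ ≤ ε := by rw [he] at h1 h2; linarith

theorem finite_extreme {d : ℕ} (V : Finset (EuclideanSpace ℝ (Fin d))) :
    {σ | IsExtreme ℝ (convexHull ℝ (V : Set (EuclideanSpace ℝ (Fin d)))) σ}.Finite := by
  classical
  let G : Finset (Finset (EuclideanSpace ℝ (Fin d))) → Set (EuclideanSpace ℝ (Fin d)) :=
    fun Q => ⋃ S ∈ Q, convexHull ℝ (S : Set (EuclideanSpace ℝ (Fin d)))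
  refine ((V.powerset.powerset.finite_toSet).image G).subset ?_
  intro σ hσ
  refine ⟨V.powerset.filter fun S => convexHull ℝ (S : Set (EuclideanSpace ℝ (Fin d))) ⊆ σ,
    Finset.mem_coe.2 (Finset.mem_powerset.2 (Finset.filter_subset _ _)), ?_⟩
  simp only [G]
  apply Set.Subset.antisymm
  · refine Set.iUnion₂_subset fun S hS => (Finset.mem_filter.1 hS).2
  · intro x hx
    obtain ⟨w, hw0, hw1, hwx⟩ := Finset.mem_convexHull'.1 (hσ.subset hx)
    let S := V.filter fun v => 0 < w v
    have hSV : S ⊆ V := Finset.filter_subset _ _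
    have hz : ∀ v ∈ V, v ∉ S → w v = 0 := by
      intro v hv hvS
      by_contra hne
      exact hvS (Finset.mem_filter.2 ⟨hv, lt_of_le_of_ne (hw0 v hv) (Ne.symm hne)⟩)
    have hS1 : ∑ v ∈ S, w v = 1 := by
      rw [← hw1]; exact Finset.sum_subset hSV hz
    have hSx : ∑ v ∈ S, w v • v = x := by
      rw [← hwx]
      exact Finset.sum_subset hSV fun v hv hvS => by rw [hz v hv hvS, zero_smul]
    have hSpos : ∀ v ∈ S, 0 < w v := fun v hv => (Finset.mem_filter.1 hv).2
    have hxS : x ∈ convexHull ℝ (S : Set (EuclideanSpace ℝ (Fin d))) :=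
      Finset.mem_convexHull'.2 ⟨w, fun v hv => (hSpos v hv).le, hS1, hSx⟩
    refine Set.mem_iUnion₂.2 ⟨S, Finset.mem_filter.2 ⟨Finset.mem_powerset.2 hSV, ?_⟩, hxS⟩
    intro z hz
    obtain ⟨u, hu0, hu1, huz⟩ := Finset.mem_convexHull'.1 hz
    have hSne : S.Nonempty := by
      by_contra hne
      rw [Finset.not_nonempty_iff_eq_empty] at hne
      rw [hne] at hS1
      simp at hS1
    obtain ⟨v0, hv0, hmin⟩ := S.exists_min_image w hSne
    have hw01 : w v0 ≤ 1 := by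
      rw [← hS1]
      exact Finset.single_le_sum (fun v hv => (hSpos v hv).le) hv0
    set t := w v0 / 2 with ht
    have htpos : 0 < t := by have := hSpos v0 hv0; positivity
    have ht1 : 0 < 1 - t := by linarith
    have hcoef : ∀ v ∈ S, 0 ≤ (w v - t * u v) / (1 - t) := by
      intro v hv
      apply div_nonneg _ ht1.le
      have h1 : u v ≤ 1 := by
        rw [← hu1]
        exact Finset.single_le_sum (f := u) (fun v hv => hu0 v hv) hv
      have h2 := hmin v hv
      nlinarith
    let z' := ∑ v ∈ S, ((w v - t * u v) / (1 - t)) • v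
    have hz' : z' ∈ convexHull ℝ (S : Set (EuclideanSpace ℝ (Fin d))) := by
      refine Finset.mem_convexHull'.2 ⟨_, hcoef, ?_, rfl⟩
      rw [← Finset.sum_div, Finset.sum_sub_distrib, ← Finset.mul_sum, hS1, hu1, mul_one,
        div_self ht1.ne']
    have hsub : convexHull ℝ (S : Set (EuclideanSpace ℝ (Fin d))) ⊆ convexHull ℝ (V : Set _) :=
      convexHull_mono (by exact_mod_cast hSV)
    refine hσ.left_mem_of_mem_openSegment (hsub hz) (hsub hz') hx ⟨t, 1 - t, htpos, ht1, by ring, ?_⟩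
    rw [← hSx, ← huz, Finset.smul_sum, Finset.smul_sum, ← Finset.sum_add_distrib]
    refine Finset.sum_congr rfl fun v _ => ?_
    rw [smul_smul, smul_smul, ← add_smul]
    congr 1
    field_simp
    ring

theorem komiya_main (d : ℕ)
    (V : Finset (EuclideanSpace ℝ (Fin d)))
    (P : Set (EuclideanSpace ℝ (Fin d))) (hP : P = convexHull ℝ ↑V)
    (hdim : affineSpan ℝ (V : Set (EuclideanSpace ℝ (Fin d))) = ⊤)
    (p : EuclideanSpace ℝ (Fin d)) (hp : p ∈ P)
    (A : Fin (d + 1) → Set (EuclideanSpace ℝ (Fin d)) → Set (EuclideanSpace ℝ (Fin d)))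
    (y : Fin (d + 1) → Set (EuclideanSpace ℝ (Fin d)) → EuclideanSpace ℝ (Fin d))
    (hA : ∀ i τ, IsProperFace P τ → IsClosed (A i τ) ∧ A i τ ⊆ P)
    (hy : ∀ i τ, IsProperFace P τ → y i τ ∈ τ)
    (hcover : ∀ i, ∀ σ, IsFace P σ →
      σ ⊆ ⋃ τ ∈ {τ | IsProperFace P τ ∧ τ ⊆ σ}, A i τ) :
    ∃ τ : Fin (d + 1) → Set (EuclideanSpace ℝ (Fin d)),
      (∀ i, IsProperFace P (τ i)) ∧
      p ∈ convexHull ℝ (Set.range fun i => y i (τ i)) ∧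
      (⋂ i, A i (τ i)).Nonempty := by
  classical
  have hconv : Convex ℝ P := hP ▸ convex_convexHull ℝ _
  have hcomp : IsCompact P := hP ▸ V.finite_toSet.isCompact_convexHull ℝ
  obtain ⟨q, hq⟩ : (interior P).Nonempty := by
    rw [hP, interior_convexHull_nonempty_iff_affineSpan_eq_top]; exact hdim
  have hfin : {σ | IsProperFace P σ}.Finite := by
    refine (finite_extreme V).subset fun σ hσ => ?_
    have := hσ.2.2
    rwa [hP] at this
  have hseq : ∀ n : ℕ, ∃ τ : Fin (d + 1) → Set (EuclideanSpace ℝ (Fin d)),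
      ∃ x : Fin (d + 1) → EuclideanSpace ℝ (Fin d), (∀ i, IsProperFace P (τ i)) ∧
      p + (1 / ((n : ℝ) + 1)) • (q - p) ∈ convexHull ℝ (Set.range fun i => y i (τ i)) ∧
      (∀ i, x i ∈ A i (τ i)) ∧ ∀ i j, dist (x i) (x j) ≤ 1 / ((n : ℝ) + 1) := by
    intro n
    have hn : (0 : ℝ) < 1 / ((n : ℝ) + 1) := by positivity
    have hn1 : 1 / ((n : ℝ) + 1) ≤ 1 := by
      rw [div_le_one (by positivity)]
      have : (0 : ℝ) ≤ n := by positivity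
      linarith
    exact komiya_approx P hconv hcomp _ (hconv.add_smul_sub_mem_interior hp hq ⟨hn, hn1⟩)
      A y hy hcover _ hn
  choose τ x hτ hpn hxA hxd using hseq
  have : Finite {σ | IsProperFace P σ} := hfin
  obtain ⟨τ0, hτ0⟩ := Finite.exists_infinite_fiber
    (fun (n : ℕ) (i : Fin (d + 1)) => (⟨τ n i, hτ n i⟩ : {σ | IsProperFace P σ}))
  rw [Set.infinite_coe_iff] at hτ0
  obtain ⟨φ, hφ, hφτ⟩ := Filter.extraction_of_frequently_atTop
    (Nat.frequently_atTop_iff_infinite.2 hτ0)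
  have hφτ' : ∀ n i, τ (φ n) i = (τ0 i).1 := fun n i => by
    have h1 := hφτ n
    simp only [mem_preimage, mem_singleton_iff] at h1
    exact congrArg Subtype.val (congrFun h1 i)
  obtain ⟨z, -, ψ, hψ, hlim⟩ := hcomp.tendsto_subseq (x := fun n => x (φ n) 0)
    fun n => (hA 0 _ (hτ _ 0)).2 (hxA (φ n) 0)
  have hone : Filter.Tendsto (fun n : ℕ => 1 / ((n : ℝ) + 1)) Filter.atTop (nhds 0) :=
    tendsto_one_div_add_atTop_nhds_zero_nat
  refine ⟨fun i => (τ0 i).1, fun i => (τ0 i).2, ?_, z, ?_⟩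
  · have hcl : IsClosed (convexHull ℝ (Set.range fun i => y i (τ0 i).1)) :=
      ((Set.finite_range _).isCompact_convexHull ℝ).isClosed
    have hl : Filter.Tendsto (fun n : ℕ => p + (1 / ((n : ℝ) + 1)) • (q - p)) Filter.atTop
        (nhds p) := by
      have := (hone.smul_const (q - p)).const_add p
      simpa using this
    refine hcl.mem_of_tendsto (hl.comp hφ.tendsto_atTop) (Filter.Eventually.of_forall fun n => ?_)
    have := hpn (φ n)
    simp only [hφτ'] at this
    exact this
  · refine Set.mem_iInter.2 fun i => ?_
    have hl : Filter.Tendsto (fun n => x (φ (ψ n)) i) Filter.atTop (nhds z) := by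
      refine tendsto_of_tendsto_of_dist hlim ?_
      refine squeeze_zero (fun _ => dist_nonneg) (fun n => hxd (φ (ψ n)) 0 i) ?_
      exact hone.comp (hφ.tendsto_atTop.comp hψ.tendsto_atTop)
    refine (hA i _ (τ0 i).2).1.mem_of_tendsto hl (Filter.Eventually.of_forall fun n => ?_)
    have := hxA (φ (ψ n)) i
    rwa [hφτ'] at this

/-- The colorful Komiya theorem of Frick and Zerbib. -/
theorem colorful_komiya (k : ℕ) (hk : 1 ≤ k)
    (V : Finset (EuclideanSpace ℝ (Fin (k - 1))))
    (P : Set (EuclideanSpace ℝ (Fin (k - 1)))) (hP : P = convexHull ℝ ↑V)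
    (hdim : affineSpan ℝ (V : Set (EuclideanSpace ℝ (Fin (k - 1)))) = ⊤)
    (p : EuclideanSpace ℝ (Fin (k - 1))) (hp : p ∈ P)
    (A : Fin k → Set (EuclideanSpace ℝ (Fin (k - 1))) → Set (EuclideanSpace ℝ (Fin (k - 1))))
    (y : Fin k → Set (EuclideanSpace ℝ (Fin (k - 1))) → EuclideanSpace ℝ (Fin (k - 1)))
    (hA : ∀ i τ, IsProperFace P τ → IsClosed (A i τ) ∧ A i τ ⊆ P)
    (hy : ∀ i τ, IsProperFace P τ → y i τ ∈ τ)
    (hcover : ∀ i, ∀ σ, IsFace P σ →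
      σ ⊆ ⋃ τ ∈ {τ | IsProperFace P τ ∧ τ ⊆ σ}, A i τ) :
    ∃ τ : Fin k → Set (EuclideanSpace ℝ (Fin (k - 1))),
      (∀ i, IsProperFace P (τ i)) ∧
      p ∈ convexHull ℝ (Set.range fun i => y i (τ i)) ∧
      (⋂ i, A i (τ i)).Nonempty := by
  obtain ⟨d, rfl⟩ : ∃ d, k = d + 1 := ⟨k - 1, by omega⟩
  exact komiya_main d V P hP hdim p hp A y hA hy hcover
end
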